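/- arXiv:1208.3582 — 2 statements merged into one kernel-verified Lean document; each statement's English description precedes it below -/
import Mathlib

section
/- Let p ∈ ℝ⟨x⟩ be symmetric and suppose −p is not a hermitian sum of squares. For each n let K(n) denote the set of X ∈ 𝕊ₙ(ℝ^g) such that p(X) has a positive eigenvalue. If q ∈ ℝ⟨x⟩ satisfies det(q(X)) = 0 for every positive integer n and every X ∈ K(n), then q is the zero polynomial. -/
open scoped BigOperators

noncomputable section

/-- Evaluation of a free polynomial `p ∈ ℝ⟨x₁,…,x_g⟩` at a `g`-tuple of square matrices;
the empty word evaluates to the identity matrix. -/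
def evalMat {g : ℕ} {ι : Type} [Fintype ι] [DecidableEq ι]
    (p : FreeAlgebra ℝ (Fin g)) (X : Fin g → Matrix ι ι ℝ) : Matrix ι ι ℝ :=
  FreeAlgebra.lift ℝ X p

/-- `p` is a hermitian sum of squares: `p = Σⱼ hⱼ* hⱼ`. -/
def IsHermitianSOS {g : ℕ} (p : FreeAlgebra ℝ (Fin g)) : Prop :=
  ∃ (m : ℕ) (h : Fin m → FreeAlgebra ℝ (Fin g)), p = ∑ j, star (h j) * h j

/-- `p` is quasi-convex: `p(0) = 0` and for every positive integer `n` and every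
positive definite `A ∈ 𝕊ₙ(ℝ)`, the set `{X ∈ 𝕊ₙ(ℝ^g) : A − p(X) ≻ 0}` is convex. -/
def IsQuasiConvex {g : ℕ} (p : FreeAlgebra ℝ (Fin g)) : Prop :=
  (∀ n : ℕ, evalMat p (fun _ => (0 : Matrix (Fin n) (Fin n) ℝ)) = 0) ∧
  ∀ n : ℕ, 0 < n → ∀ A : Matrix (Fin n) (Fin n) ℝ, A.PosDef →
    Convex ℝ {X : Fin g → Matrix (Fin n) (Fin n) ℝ |
      (∀ j, (X j).IsSymm) ∧ (A - evalMat p X).PosDef}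

/-- The space of free polynomials homogeneous of degree one (linear span of the variables).  -/
def degOne (g : ℕ) : Submodule ℝ (FreeAlgebra ℝ (Fin g)) :=
  Submodule.span ℝ (Set.range (FreeAlgebra.ι ℝ : Fin g → FreeAlgebra ℝ (Fin g)))

/-- The space of free polynomials of degree at most `k`. -/
def degLE (g k : ℕ) : Submodule ℝ (FreeAlgebra ℝ (Fin g)) :=
  ⨆ i ∈ Finset.range (k + 1), (degOne g) ^ i

/-- `M` has a positive eigenvalue (with corresponding eigenvector). -/
def HasPosEigenvalue {n : ℕ} (M : Matrix (Fin n) (Fin n) ℝ) : Prop :=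
  ∃ (lam : ℝ) (v : Fin n → ℝ), 0 < lam ∧ v ≠ 0 ∧ M.mulVec v = lam • v

/-- The directional derivative `p′(X)[H]`: the coefficient of `t` in `t ↦ p(X + tH)`. -/
def derivEval {g n : ℕ} (p : FreeAlgebra ℝ (Fin g))
    (X H : Fin g → Matrix (Fin n) (Fin n) ℝ) : Matrix (Fin n) (Fin n) ℝ :=
  (FreeAlgebra.lift ℝ
      (fun j => Polynomial.C (X j) + Polynomial.X * Polynomial.C (H j)) p).coeff 1

/-- The Hessian `p″(X)[H]`: twice the coefficient of `t²` in `t ↦ p(X + tH)`. -/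
def hessEval {g n : ℕ} (p : FreeAlgebra ℝ (Fin g))
    (X H : Fin g → Matrix (Fin n) (Fin n) ℝ) : Matrix (Fin n) (Fin n) ℝ :=
  (2 : ℝ) • (FreeAlgebra.lift ℝ
      (fun j => Polynomial.C (X j) + Polynomial.X * Polynomial.C (H j)) p).coeff 2

/-- The constant term of a free polynomial (so that `p(0)` is `constantTerm p` times the
identity matrix). -/
def constantTerm {g : ℕ} (p : FreeAlgebra ℝ (Fin g)) : ℝ :=
  FreeAlgebra.lift ℝ (fun _ : Fin g => (0 : ℝ)) p

/-- Evaluation of a word `w = x_{j₁}⋯x_{j_k}` at a tuple of matrices: `X_{j₁}⋯X_{j_k}`. -/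
def wordEval {g n : ℕ} (X : Fin g → Matrix (Fin n) (Fin n) ℝ)
    (w : FreeMonoid (Fin g)) : Matrix (Fin n) (Fin n) ℝ :=
  (w.toList.map X).prod

section Words

variable {g : ℕ}

/-- The monomial of the free algebra given by a word. -/
def wordMonomial (w : FreeMonoid (Fin g)) : FreeAlgebra ℝ (Fin g) :=
  FreeMonoid.lift (FreeAlgebra.ι ℝ) w

/-- The coefficients of a free polynomial, indexed by words. -/
def wordCoeff : FreeAlgebra ℝ (Fin g) →ₗ[ℝ] (FreeMonoid (Fin g) → ℝ) where
  toFun p w := (FreeAlgebra.equivMonoidAlgebraFreeMonoid p).coeff w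
  map_add' p q := by ext w; simp
  map_smul' r p := by ext w; simp

/-- The words occurring in a free polynomial. -/
def wordSupport (p : FreeAlgebra ℝ (Fin g)) : Finset (FreeMonoid (Fin g)) :=
  (FreeAlgebra.equivMonoidAlgebraFreeMonoid p).coeff.support

lemma mem_wordSupport {p : FreeAlgebra ℝ (Fin g)} {w : FreeMonoid (Fin g)} :
    w ∈ wordSupport p ↔ wordCoeff p w ≠ 0 := by
  simp [wordSupport, wordCoeff]

lemma sum_wordCoeff_smul (p : FreeAlgebra ℝ (Fin g)) :
    p = ∑ w ∈ wordSupport p, wordCoeff p w • wordMonomial w := by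
  apply FreeAlgebra.equivMonoidAlgebraFreeMonoid.injective
  apply FreeAlgebra.equivMonoidAlgebraFreeMonoid.symm.injective
  rw [AlgEquiv.symm_apply_apply, AlgEquiv.symm_apply_apply]
  conv_lhs => rw [← FreeAlgebra.equivMonoidAlgebraFreeMonoid.symm_apply_apply p]
  change MonoidAlgebra.lift ℝ _ _ _ _ = _
  rw [MonoidAlgebra.lift_apply]
  rfl

lemma wordCoeff_injective : Function.Injective (wordCoeff (g := g)) := by
  intro p q h
  apply FreeAlgebra.equivMonoidAlgebraFreeMonoid.injective
  ext w
  exact congrFun h w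

open Classical in
lemma wordCoeff_wordMonomial (w : FreeMonoid (Fin g)) :
    wordCoeff (wordMonomial w) = Pi.single w 1 := by
  have h : FreeAlgebra.equivMonoidAlgebraFreeMonoid (wordMonomial w)
      = MonoidAlgebra.of ℝ (FreeMonoid (Fin g)) w := by
    induction w using FreeMonoid.inductionOn' with
    | one => simp [wordMonomial, MonoidAlgebra.one_def]
    | of_mul x w ih =>
      rw [wordMonomial, map_mul, map_mul, map_mul, ← ih]
      simp [wordMonomial, FreeAlgebra.equivMonoidAlgebraFreeMonoid]
  ext v
  change (FreeAlgebra.equivMonoidAlgebraFreeMonoid (wordMonomial w)).coeff v = _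
  rw [h]
  simp [Finsupp.single_apply, Pi.single_apply, eq_comm]

lemma wordMonomial_mul (u v : FreeMonoid (Fin g)) :
    wordMonomial (u * v) = wordMonomial u * wordMonomial v := map_mul _ u v

lemma star_wordMonomial (w : FreeMonoid (Fin g)) :
    star (wordMonomial w) = wordMonomial (star w) := by
  induction w using FreeMonoid.inductionOn' with
  | one => simp [wordMonomial]
  | of_mul x w ih =>
    rw [wordMonomial_mul, star_mul, star_mul, wordMonomial_mul, ih]
    simp [wordMonomial]

lemma length_star (w : FreeMonoid (Fin g)) : (star w).length = w.length :=
  List.length_reverse (as := w)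

variable {ι κ : Type} [Fintype ι] [DecidableEq ι] [Fintype κ] [DecidableEq κ]

lemma star_smul_freeAlgebra (r : ℝ) (p : FreeAlgebra ℝ (Fin g)) : star (r • p) = r • star p := by
  rw [Algebra.smul_def, star_mul, FreeAlgebra.star_algebraMap, Algebra.smul_def, Algebra.commutes]

lemma evalMat_mul (p q : FreeAlgebra ℝ (Fin g)) (X : Fin g → Matrix ι ι ℝ) :
    evalMat (p * q) X = evalMat p X * evalMat q X := map_mul _ _ _

lemma evalMat_wordMonomial (w : FreeMonoid (Fin g)) (X : Fin g → Matrix ι ι ℝ) :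
    evalMat (wordMonomial w) X = FreeMonoid.lift X w := by
  induction w using FreeMonoid.inductionOn' with
  | one => simp [wordMonomial, evalMat]
  | of_mul x w ih =>
    rw [wordMonomial_mul, evalMat_mul, ih, map_mul]
    simp [wordMonomial, evalMat]

lemma evalMat_eq_sum (p : FreeAlgebra ℝ (Fin g)) (X : Fin g → Matrix ι ι ℝ) :
    evalMat p X = ∑ w ∈ wordSupport p, wordCoeff p w • FreeMonoid.lift X w := by
  conv_lhs => rw [evalMat, sum_wordCoeff_smul p]
  rw [map_sum]
  refine Finset.sum_congr rfl fun w _ => ?_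
  rw [map_smul, ← evalMat_wordMonomial, evalMat]

lemma evalMat_star (p : FreeAlgebra ℝ (Fin g)) (X : Fin g → Matrix ι ι ℝ) :
    evalMat (star p) X = (evalMat p fun j => (X j).transpose).transpose := by
  induction p using FreeAlgebra.induction with
  | grade0 r => simp [evalMat, Matrix.algebraMap_eq_diagonal]
  | grade1 x => simp [evalMat]
  | mul a b ha hb => rw [star_mul, evalMat_mul, evalMat_mul, ha, hb, Matrix.transpose_mul]
  | add a b ha hb =>
    simp only [evalMat, star_add, map_add, Matrix.transpose_add] at *
    rw [ha, hb]

lemma evalMat_map {R : Type*} [Ring R] [Algebra ℝ R] (φ : Matrix ι ι ℝ →ₐ[ℝ] R)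
    (p : FreeAlgebra ℝ (Fin g)) (X : Fin g → Matrix ι ι ℝ) :
    φ (evalMat p X) = FreeAlgebra.lift ℝ (fun j => φ (X j)) p := by
  have : φ.comp (FreeAlgebra.lift ℝ X) = FreeAlgebra.lift ℝ (fun j => φ (X j)) := by
    ext j; simp
  rw [← this]; rfl

/-- Intertwined tuples have intertwined values. -/
lemma evalMat_intertwine (p : FreeAlgebra ℝ (Fin g)) {X : Fin g → Matrix ι ι ℝ}
    {Y : Fin g → Matrix κ κ ℝ} {U : Matrix ι κ ℝ} (h : ∀ j, X j * U = U * Y j) :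
    evalMat p X * U = U * evalMat p Y := by
  induction p using FreeAlgebra.induction with
  | grade0 r => simp [evalMat, Algebra.algebraMap_eq_smul_one]
  | grade1 x => simpa [evalMat] using h x
  | mul a b ha hb =>
    rw [evalMat_mul, evalMat_mul, Matrix.mul_assoc, hb, ← Matrix.mul_assoc, ha, Matrix.mul_assoc]
  | add a b ha hb =>
    simp only [evalMat, map_add, Matrix.add_mul, Matrix.mul_add] at *
    rw [ha, hb]

lemma det_evalMat_eq_of_intertwine (p : FreeAlgebra ℝ (Fin g)) {X Y : Fin g → Matrix ι ι ℝ}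
    {U : Matrix ι ι ℝ} (hU : U.det ≠ 0) (h : ∀ j, X j * U = U * Y j) :
    (evalMat p X).det = (evalMat p Y).det := by
  have := congrArg Matrix.det (evalMat_intertwine p h)
  rw [Matrix.det_mul, Matrix.det_mul, mul_comm] at this
  exact mul_left_cancel₀ hU this

lemma evalMat_fromBlocks_diagonal (p : FreeAlgebra ℝ (Fin g)) (X : Fin g → Matrix ι ι ℝ)
    (Y : Fin g → Matrix κ κ ℝ) :
    evalMat p (fun j => Matrix.fromBlocks (X j) 0 0 (Y j))
      = Matrix.fromBlocks (evalMat p X) 0 0 (evalMat p Y) := by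
  induction p using FreeAlgebra.induction with
  | grade0 r =>
    simp [evalMat, Algebra.algebraMap_eq_smul_one, ← Matrix.fromBlocks_one, Matrix.fromBlocks_smul]
  | grade1 x => simp [evalMat]
  | mul a b ha hb => simp [evalMat_mul, ha, hb, Matrix.fromBlocks_multiply]
  | add a b ha hb =>
    simp only [evalMat, map_add] at *
    rw [ha, hb, Matrix.fromBlocks_add]; simp

lemma evalMat_reindex (e : ι ≃ κ) (p : FreeAlgebra ℝ (Fin g)) (X : Fin g → Matrix ι ι ℝ) :
    evalMat p (fun j => Matrix.reindex e e (X j)) = Matrix.reindex e e (evalMat p X) :=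
  (evalMat_map (Matrix.reindexAlgEquiv ℝ ℝ e).toAlgHom p X).symm

/-- The determinant is polynomial along affine lines. -/
lemma exists_polynomial_det_evalMat (q : FreeAlgebra ℝ (Fin g)) (X H : Fin g → Matrix ι ι ℝ) :
    ∃ P : Polynomial ℝ, ∀ t : ℝ, P.eval t = (evalMat q fun j => X j + t • H j).det := by
  let Y : Fin g → Matrix ι ι (Polynomial ℝ) := fun j =>
    (X j).map Polynomial.C + (Polynomial.X : Polynomial ℝ) • (H j).map Polynomial.C
  refine ⟨(FreeAlgebra.lift ℝ Y q).det, fun t => ?_⟩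
  have h : ((Polynomial.aeval t).mapMatrix).comp (FreeAlgebra.lift ℝ Y)
      = FreeAlgebra.lift ℝ (fun j => X j + t • H j) := by
    ext j a b
    simp [Y, mul_comm t]
  rw [evalMat, ← h, ← Polynomial.coe_aeval_eq_eval, AlgHom.comp_apply, ← AlgHom.map_det]

lemma continuous_evalMat (p : FreeAlgebra ℝ (Fin g)) :
    Continuous fun X : Fin g → Matrix ι ι ℝ => evalMat p X := by
  induction p using FreeAlgebra.induction with
  | grade0 r => simpa [evalMat] using continuous_const
  | grade1 x => simpa [evalMat] using continuous_apply x
  | mul a b ha hb => simp only [evalMat_mul]; exact ha.mul hb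
  | add a b ha hb => simp only [evalMat, map_add]; exact ha.add hb

end Words

section CyclicShift

variable {g N : ℕ} [NeZero N]

/-- Weighted cyclic shifts: the `j`-th matrix sends `e_c` to `a (j, c) • e_{c + 1}`. -/
def cyclicShift (a : Fin g × ZMod N → ℝ) (j : Fin g) : Matrix (ZMod N) (ZMod N) ℝ :=
  Matrix.of fun r c => if r = c + 1 then a (j, c) else 0

/-- The exponents of the weights picked up by a word of cyclic shifts applied to `e_c`. -/
def cyclicExponent (c : ZMod N) : List (Fin g) → (Fin g × ZMod N →₀ ℕ)
  | [] => 0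
  | j :: w => Finsupp.single (j, c + w.length) 1 + cyclicExponent c w

omit [NeZero N] in
lemma cyclicExponent_apply_eq_zero (c : ZMod N) (w : List (Fin g)) (j : Fin g) {k : ℕ}
    (hk : w.length ≤ k) (hkN : k < N) : cyclicExponent c w (j, c + k) = 0 := by
  induction w with
  | nil => rfl
  | cons i w ih =>
    simp only [List.length_cons] at hk
    have : (w.length : ZMod N) ≠ k := by
      rw [Ne, ZMod.natCast_eq_natCast_iff', Nat.mod_eq_of_lt hkN, Nat.mod_eq_of_lt (by omega)]
      omega
    simp [cyclicExponent, ih (by omega), this]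

omit [NeZero N] in
lemma cyclicExponent_injective (c : ZMod N) {u v : List (Fin g)} (huv : u.length = v.length)
    (hu : u.length ≤ N) (h : cyclicExponent c u = cyclicExponent c v) : u = v := by
  induction u generalizing v with
  | nil => exact (List.length_eq_zero_iff.mp huv.symm).symm
  | cons i u ih =>
    cases v with
    | nil => simp at huv
    | cons j v =>
      simp only [List.length_cons] at huv hu
      have hij : i = j := by
        have h1 := DFunLike.congr_fun h (i, c + (u.length : ZMod N))
        simp only [cyclicExponent, Finsupp.add_apply, Finsupp.single_eq_same] at h1
        rw [cyclicExponent_apply_eq_zero c u i le_rfl (by omega),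
          cyclicExponent_apply_eq_zero c v i (by omega) (by omega)] at h1
        by_contra hne
        simp [Ne.symm hne] at h1
      subst hij
      simp only [cyclicExponent, show u.length = v.length by omega, add_right_inj] at h
      rw [ih (by omega) (by omega) h]

lemma lift_cyclicShift_apply (a : Fin g × ZMod N → ℝ) (w : FreeMonoid (Fin g)) (r c : ZMod N) :
    FreeMonoid.lift (cyclicShift a) w r c = if r = c + w.length then
      MvPolynomial.eval a (MvPolynomial.monomial (cyclicExponent c w.toList) 1) else 0 := by
  induction w using FreeMonoid.inductionOn' generalizing r with
  | one => simp [Matrix.one_apply, cyclicExponent]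
  | of_mul x w ih =>
    rw [map_mul, Matrix.mul_apply, Finset.sum_eq_single (c + (w.length : ZMod N))]
    · rw [ih]
      have : MvPolynomial.monomial (cyclicExponent c (FreeMonoid.of x * w).toList) (1 : ℝ)
          = MvPolynomial.X (x, c + (w.length : ZMod N))
            * MvPolynomial.monomial (cyclicExponent c w.toList) 1 := by
        rw [MvPolynomial.X, MvPolynomial.monomial_mul, one_mul]; rfl
      rw [this, map_mul]
      simp [cyclicShift, add_assoc, add_comm (1 : ZMod N)]
    · intro b _ hb
      rw [ih, if_neg hb, mul_zero]
    · simp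

/-- A nonzero free polynomial takes an invertible value at some tuple of real matrices. -/
theorem exists_det_evalMat_ne_zero {q : FreeAlgebra ℝ (Fin g)} (hq : q ≠ 0) :
    ∃ (N : ℕ) (_ : NeZero N) (A : Fin g → Matrix (ZMod N) (ZMod N) ℝ),
      (evalMat q A).det ≠ 0 := by
  classical
  have hne : (wordSupport q).Nonempty := by
    rw [Finset.nonempty_iff_ne_empty]
    intro h
    apply hq
    rw [sum_wordCoeff_smul q, h, Finset.sum_empty]
  obtain ⟨w₀, hw₀, hmax⟩ := (wordSupport q).exists_max_image FreeMonoid.length hne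
  set d := w₀.length with hd
  refine ⟨d + 1, inferInstance, ?_⟩
  let T := (wordSupport q).filter fun w => w.length = d
  let P : ZMod (d + 1) → MvPolynomial (Fin g × ZMod (d + 1)) ℝ := fun c =>
    ∑ w ∈ T, MvPolynomial.monomial (cyclicExponent c w.toList) (wordCoeff q w)
  have hP : ∀ c, P c ≠ 0 := by
    intro c h0
    have h1 := congrArg (MvPolynomial.coeff (cyclicExponent c w₀.toList)) h0
    simp only [P, MvPolynomial.coeff_sum, MvPolynomial.coeff_monomial,
      MvPolynomial.coeff_zero] at h1
    rw [Finset.sum_eq_single w₀] at h1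
    · rw [if_pos rfl] at h1
      exact mem_wordSupport.mp hw₀ h1
    · intro w hw hne
      refine if_neg fun h => hne ?_
      have hl : w.length = d := (Finset.mem_filter.mp hw).2
      exact cyclicExponent_injective c (u := w.toList) (v := w₀.toList) hl
        (by change w.length ≤ _; omega) h
    · intro h
      exact absurd (show w₀ ∈ T from Finset.mem_filter.mpr ⟨hw₀, hd.symm⟩) h
  obtain ⟨a, ha⟩ : ∃ a, MvPolynomial.eval a (∏ c, P c) ≠ 0 := by
    by_contra! h
    exact Finset.prod_ne_zero_iff.mpr (fun c _ => hP c) (MvPolynomial.funext (by simpa using h))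
  rw [map_prod, Finset.prod_ne_zero_iff] at ha
  let F : ℝ → Matrix (ZMod (d + 1)) (ZMod (d + 1)) ℝ := fun s =>
    ∑ w ∈ wordSupport q, (s ^ (d - w.length) * wordCoeff q w) • FreeMonoid.lift (cyclicShift a) w
  have hF0 : (F 0).det ≠ 0 := by
    have hF : F 0 = (Matrix.diagonal fun c => MvPolynomial.eval a (P c)).submatrix
        (Equiv.subRight (d : ZMod (d + 1))) id := by
      ext r c
      simp only [F, Matrix.sum_apply, Matrix.smul_apply, lift_cyclicShift_apply,
        Matrix.submatrix_apply, Equiv.subRight_apply, id, Matrix.diagonal_apply, P, map_sum, T,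
        Finset.sum_filter]
      split_ifs with h
      · refine Finset.sum_congr rfl fun w hw => ?_
        split_ifs with h1 h2 h2
        · simp [h2, h, MvPolynomial.eval_monomial]
        · simp [zero_pow (show d - w.length ≠ 0 by have := hmax w hw; omega)]
        · exact absurd (by rw [h2, ← h]; ring) h1
        · simp
      · refine Finset.sum_eq_zero fun w hw => ?_
        split_ifs with h1
        · have h2 : w.length ≠ d := fun h2 => h (by rw [h1, h2]; ring)
          simp [zero_pow (show d - w.length ≠ 0 by have := hmax w hw; omega)]
        · simp
    rw [hF, Matrix.det_permute, Matrix.det_diagonal]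
    refine mul_ne_zero ?_ (Finset.prod_ne_zero_iff.mpr ha)
    exact_mod_cast (Equiv.Perm.sign _).ne_zero
  have hcont : Continuous fun s => (F s).det := by
    apply Continuous.matrix_det
    fun_prop
  obtain ⟨s, hs, hs0⟩ : ∃ s, (F s).det ≠ 0 ∧ s ≠ 0 := by
    have h1 : ∀ᶠ s in nhdsWithin (0 : ℝ) {0}ᶜ, (F s).det ≠ 0 :=
      (hcont.continuousAt.eventually_ne hF0).filter_mono nhdsWithin_le_nhds
    exact (h1.and self_mem_nhdsWithin).exists
  refine ⟨fun j => s⁻¹ • cyclicShift a j, fun h => hs ?_⟩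
  have hFs : F s = s ^ d • evalMat q fun j => s⁻¹ • cyclicShift a j := by
    rw [evalMat_eq_sum, Finset.smul_sum]
    refine Finset.sum_congr rfl fun w hw => ?_
    have hscale : ∀ w : FreeMonoid (Fin g), FreeMonoid.lift (fun j => s⁻¹ • cyclicShift a j) w
        = (s⁻¹) ^ w.length • FreeMonoid.lift (cyclicShift a) w := by
      intro w
      induction w using FreeMonoid.inductionOn' with
      | one => simp
      | of_mul x w ih =>
        rw [map_mul, map_mul, ih]
        simp [pow_add, smul_smul, mul_comm]
    rw [hscale, smul_smul, smul_smul]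
    congr 1
    rw [← Nat.sub_add_cancel (hmax w hw), pow_add]
    simp only [Nat.add_sub_cancel, inv_pow]
    field_simp
  rw [hFs, Matrix.det_smul, h, mul_zero]

end CyclicShift

/-- A nonzero free polynomial takes an invertible value at some tuple of real symmetric
matrices. -/
theorem exists_isSymm_det_evalMat_ne_zero {g : ℕ} {q : FreeAlgebra ℝ (Fin g)} (hq : q ≠ 0) :
    ∃ (ι : Type) (_ : Fintype ι) (_ : DecidableEq ι) (_ : Nonempty ι)
      (Z : Fin g → Matrix ι ι ℝ), (∀ j, (Z j).IsSymm) ∧ (evalMat q Z).det ≠ 0 := by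
  obtain ⟨N, _, A, hA⟩ := exists_det_evalMat_ne_zero
    (mul_ne_zero hq (star_ne_zero.mpr hq) : q * star q ≠ 0)
  rw [evalMat_mul, Matrix.det_mul, evalMat_star, Matrix.det_transpose] at hA
  refine ⟨ZMod N ⊕ ZMod N, inferInstance, inferInstance, inferInstance, ?_⟩
  by_contra! hZ
  let B : Fin g → Matrix (ZMod N ⊕ ZMod N) (ZMod N ⊕ ZMod N) ℝ := fun j =>
    Matrix.fromBlocks (A j + (A j).transpose) 0 ((A j).transpose - A j) (A j + (A j).transpose)
  let C : Fin g → Matrix (ZMod N ⊕ ZMod N) (ZMod N ⊕ ZMod N) ℝ := fun j =>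
    Matrix.fromBlocks 0 (A j - (A j).transpose) 0 0
  obtain ⟨P, hP⟩ := exists_polynomial_det_evalMat q
    (fun j => (1 / 2 : ℝ) • B j) (fun j => (1 / 2 : ℝ) • C j)
  have hpos : ∀ s : ℝ, 0 < s → P.eval (s ^ 2) = 0 := by
    intro s hs
    let U : Matrix (ZMod N ⊕ ZMod N) (ZMod N ⊕ ZMod N) ℝ := Matrix.fromBlocks 1 0 0 (s • 1)
    let Z : Fin g → Matrix (ZMod N ⊕ ZMod N) (ZMod N ⊕ ZMod N) ℝ := fun j =>
      (1 / 2 : ℝ) • Matrix.fromBlocks (A j + (A j).transpose) (s • (A j - (A j).transpose))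
        (s • ((A j).transpose - A j)) (A j + (A j).transpose)
    rw [hP, ← det_evalMat_eq_of_intertwine q (X := Z) (U := U)]
    · apply hZ
      intro j
      simp only [Z, Matrix.IsSymm, Matrix.transpose_smul, Matrix.fromBlocks_transpose,
        Matrix.transpose_add, Matrix.transpose_sub, Matrix.transpose_transpose]
      rw [add_comm (A j).transpose]
    · simp [U, hs.ne']
    · intro j
      simp only [Z, U, B, C, Matrix.fromBlocks_smul, Matrix.fromBlocks_add,
        Matrix.fromBlocks_multiply, Matrix.fromBlocks_inj]
      refine ⟨?_, ?_, ?_, ?_⟩ <;> simp [smul_smul]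
      module
  have hP0 : P = 0 := by
    apply Polynomial.eq_zero_of_infinite_isRoot
    refine (Set.Ioi_infinite (0 : ℝ)).mono fun t ht => ?_
    have := hpos (Real.sqrt t) (Real.sqrt_pos.mpr ht)
    rwa [Real.sq_sqrt (le_of_lt ht)] at this
  have h1 := hP (-1)
  let U : Matrix (ZMod N ⊕ ZMod N) (ZMod N ⊕ ZMod N) ℝ := Matrix.fromBlocks 1 1 (-1) 1
  have hU : U.det ≠ 0 := by
    simp only [U, Matrix.det_fromBlocks_one₁₁]
    rw [show (1 : Matrix (ZMod N) (ZMod N) ℝ) - -1 * 1 = (2 : ℝ) • 1 by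
      rw [two_smul]; simp, Matrix.det_smul]
    simp
  rw [hP0, Polynomial.eval_zero, det_evalMat_eq_of_intertwine q
    (Y := fun j => Matrix.fromBlocks (A j) 0 0 (A j).transpose) hU,
    evalMat_fromBlocks_diagonal, Matrix.det_fromBlocks_zero₂₁] at h1
  · exact hA h1.symm
  · intro j
    simp only [U, B, C, Matrix.fromBlocks_smul, Matrix.fromBlocks_add,
      Matrix.fromBlocks_multiply, Matrix.fromBlocks_inj]
    refine ⟨?_, ?_, ?_, ?_⟩ <;> simp <;> module

section Separation

variable {g d : ℕ}

/-- Words of length at most `d`. -/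
abbrev ShortWord (g d : ℕ) : Type := {w : FreeMonoid (Fin g) // w.length ≤ d}

instance : Fintype (ShortWord g d) :=
  haveI : Finite (ShortWord g d) := (List.finite_length_le (Fin g) d).to_subtype
  Fintype.ofFinite _

instance : DecidableEq (ShortWord g d) := Classical.decEq _

/-- The free polynomial with a given Gram matrix. -/
def gramPolynomial : Matrix (ShortWord g d) (ShortWord g d) ℝ →ₗ[ℝ] FreeAlgebra ℝ (Fin g) where
  toFun G := ∑ u, ∑ v, G u v • (star (wordMonomial u.1) * wordMonomial v.1)
  map_add' G H := by simp [add_smul, Finset.sum_add_distrib]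
  map_smul' r G := by simp [mul_smul, Finset.smul_sum]

lemma gramPolynomial_apply (G : Matrix (ShortWord g d) (ShortWord g d) ℝ) :
    gramPolynomial G = ∑ u, ∑ v, G u v • (star (wordMonomial u.1) * wordMonomial v.1) := rfl

lemma gramPolynomial_transpose_mul_self (B : Matrix (ShortWord g d) (ShortWord g d) ℝ) :
    gramPolynomial (B.transpose * B)
      = ∑ i, star (∑ u, B i u • wordMonomial u.1) * ∑ u, B i u • wordMonomial u.1 := by
  simp only [gramPolynomial_apply, Matrix.mul_apply, Matrix.transpose_apply, star_sum,
    star_smul_freeAlgebra, Finset.sum_mul_sum, smul_mul_smul_comm, Finset.sum_smul]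
  conv_rhs => rw [Finset.sum_comm]
  exact Finset.sum_congr rfl fun u _ => Finset.sum_comm

lemma isHermitianSOS_sum {ι : Type*} [Fintype ι] (h : ι → FreeAlgebra ℝ (Fin g)) :
    IsHermitianSOS (∑ i, star (h i) * h i) :=
  ⟨Fintype.card ι, h ∘ (Fintype.equivFin ι).symm,
    ((Fintype.equivFin ι).symm.sum_comp fun i => star (h i) * h i).symm⟩

lemma eq_zero_of_gramPolynomial_eq_zero {B : Matrix (ShortWord g d) (ShortWord g d) ℝ}
    (h : gramPolynomial (B.transpose * B) = 0) : B = 0 := by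
  classical
  by_contra hB
  let S := Finset.univ.filter fun u : ShortWord g d => ∃ i, B i u ≠ 0
  have hS : S.Nonempty := by
    by_contra hS
    rw [Finset.not_nonempty_iff_eq_empty, Finset.filter_eq_empty_iff] at hS
    apply hB
    ext i u
    by_contra hiu
    exact hS (Finset.mem_univ u) ⟨i, hiu⟩
  obtain ⟨u, hu, hmax⟩ := S.exists_max_image (fun u => u.1.length) hS
  have hG : ∀ v w, (B.transpose * B) v w ≠ 0 → v ∈ S ∧ w ∈ S := by
    intro v w hvw
    rw [Matrix.mul_apply] at hvw
    obtain ⟨i, _, hi⟩ := Finset.exists_ne_zero_of_sum_ne_zero hvw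
    exact ⟨Finset.mem_filter.mpr ⟨Finset.mem_univ _, i, left_ne_zero_of_mul hi⟩,
      Finset.mem_filter.mpr ⟨Finset.mem_univ _, i, right_ne_zero_of_mul hi⟩⟩
  have h1 := congrFun (congrArg wordCoeff h) (star u.1 * u.1)
  simp only [gramPolynomial_apply, star_wordMonomial, ← wordMonomial_mul, map_sum, map_smul,
    wordCoeff_wordMonomial, Finset.sum_apply, Pi.smul_apply, map_zero, Pi.zero_apply,
    smul_eq_mul] at h1
  rw [Finset.sum_eq_single u, Finset.sum_eq_single u] at h1
  · simp only [Pi.single_eq_same, mul_one, Matrix.mul_apply, Matrix.transpose_apply] at h1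
    rw [Finset.sum_eq_zero_iff_of_nonneg fun i _ => mul_self_nonneg _] at h1
    obtain ⟨i, hi⟩ := (Finset.mem_filter.mp hu).2
    exact hi (mul_self_eq_zero.mp (h1 i (Finset.mem_univ i)))
  · intro v _ hv
    rw [Pi.single_eq_of_ne, mul_zero]
    intro heq
    exact hv (Subtype.ext (mul_left_cancel heq).symm)
  · simp
  · intro v _ hv
    refine Finset.sum_eq_zero fun w _ => ?_
    by_contra hne
    obtain ⟨hvS, hwS⟩ := hG v w (left_ne_zero_of_mul hne)
    have heq : star u.1 * u.1 = star v.1 * w.1 := by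
      by_contra hne'
      exact hne (by rw [Pi.single_eq_of_ne hne', mul_zero])
    have hlen := congrArg FreeMonoid.length heq
    simp only [FreeMonoid.length_mul, length_star] at hlen
    have hvl := hmax v hvS
    have hwl := hmax w hwS
    have := (List.append_inj (s₁ := (star u.1).toList) (s₂ := (star v.1).toList) heq
      (by change (star u.1).length = (star v.1).length; simp only [length_star]; omega)).1
    exact hv (Subtype.ext (star_injective this).symm)
  · simp

lemma posSemidef_iff_eq_transpose_mul_self {n : Type*} [Fintype n] [DecidableEq n]
    {G : Matrix n n ℝ} : G.PosSemidef ↔ ∃ B : Matrix n n ℝ, G = B.transpose * B := by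
  constructor
  · open scoped MatrixOrder Matrix.Norms.L2Operator in
    exact fun h => CStarAlgebra.nonneg_iff_eq_star_mul_self.mp h.nonneg
  · rintro ⟨B, rfl⟩
    exact Matrix.posSemidef_conjTranspose_mul_self B

lemma isCompact_transpose_mul_self_eq_one {n : Type*} [Fintype n] [DecidableEq n] :
    IsCompact {B : Matrix n n ℝ | (B.transpose * B).trace = 1} := by
  have hK : IsCompact (Set.univ.pi fun _ => Set.univ.pi fun _ => Set.Icc (-1) 1 :
      Set (Matrix n n ℝ)) :=
    isCompact_univ_pi fun _ => isCompact_univ_pi fun _ => isCompact_Icc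
  refine hK.of_isClosed_subset (isClosed_eq ?_ continuous_const) ?_
  · exact (continuous_id.matrix_transpose.matrix_mul continuous_id).matrix_trace
  · intro B hB i _ j _
    have h1 : B i j * B i j ≤ 1 := by
      rw [← show _ = _ from hB]
      simp only [Matrix.trace, Matrix.diag]
      exact (Finset.single_le_sum (f := fun i => B i j * B i j)
        (fun i _ => mul_self_nonneg _) (Finset.mem_univ i)).trans
        (Finset.single_le_sum (f := fun j => ∑ i, B i j * B i j)
        (fun j _ => Finset.sum_nonneg fun i _ => mul_self_nonneg _) (Finset.mem_univ j))
    rw [Set.mem_Icc, ← abs_le]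
    exact abs_le_one_iff_mul_self_le_one.mpr h1

/-- Separation of a free polynomial which is not a sum of squares from the (closed) cone of
sums of squares of degree at most `2 * d`. -/
theorem exists_separating_functional {f : FreeAlgebra ℝ (Fin g)} (hf : ¬ IsHermitianSOS f)
    (d : ℕ) : ∃ L : FreeAlgebra ℝ (Fin g) →ₗ[ℝ] ℝ, L f < 0 ∧
      ∀ B : Matrix (ShortWord g d) (ShortWord g d) ℝ, (B.transpose * B).trace = 1 →
        0 < L (gramPolynomial (B.transpose * B)) := by
  classical
  let Φ : Matrix (ShortWord g d) (ShortWord g d) ℝ → FreeMonoid (Fin g) → ℝ := fun B =>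
    wordCoeff (gramPolynomial (B.transpose * B))
  let S := {B : Matrix (ShortWord g d) (ShortWord g d) ℝ | (B.transpose * B).trace = 1}
  have hΦ : Continuous Φ := by
    have : Continuous fun B : Matrix (ShortWord g d) (ShortWord g d) ℝ => B.transpose * B :=
      continuous_id.matrix_transpose.matrix_mul continuous_id
    refine continuous_pi fun w => ?_
    simp only [Φ, gramPolynomial_apply, map_sum, map_smul, Finset.sum_apply, Pi.smul_apply]
    exact continuous_finsetSum _ fun u _ => continuous_finsetSum _ fun v _ =>
      (this.matrix_elem u v).smul continuous_const
  have hcompact : IsCompact (Φ '' S) := isCompact_transpose_mul_self_eq_one.image hΦ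
  have hconvex : Convex ℝ (Φ '' S) := by
    rintro _ ⟨B, hB, rfl⟩ _ ⟨C, hC, rfl⟩ a b ha hb hab
    have hpsd : (a • (B.transpose * B) + b • (C.transpose * C)).PosSemidef :=
      ((Matrix.posSemidef_conjTranspose_mul_self B).smul ha).add
        ((Matrix.posSemidef_conjTranspose_mul_self C).smul hb)
    obtain ⟨D, hD⟩ := posSemidef_iff_eq_transpose_mul_self.mp hpsd
    refine ⟨D, ?_, ?_⟩
    · change (D.transpose * D).trace = 1
      rw [← hD, Matrix.trace_add, Matrix.trace_smul, Matrix.trace_smul, show _ = _ from hB,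
        show _ = _ from hC]
      simpa using hab
    · simp only [Φ]
      rw [← hD, map_add, map_smul, map_smul, map_add, map_smul, map_smul]
  let T := (fun t : ℝ => t • wordCoeff f) '' Set.Ici 0
  have hf0 : wordCoeff f ≠ 0 := by
    intro h
    apply hf
    rw [wordCoeff_injective (h.trans (map_zero _).symm)]
    exact ⟨0, 0, by simp⟩
  have hTconvex : Convex ℝ T :=
    (convex_Ici 0).is_linear_image (LinearMap.toSpanSingleton ℝ _ (wordCoeff f)).isLinear
  have hTclosed : IsClosed T :=
    (isClosedEmbedding_smul_left hf0).isClosedMap _ isClosed_Ici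
  have hdisj : Disjoint (Φ '' S) T := by
    rw [Set.disjoint_left]
    rintro _ ⟨B, hB, rfl⟩ ⟨t, ht, hBt⟩
    have hBt' : t • f = gramPolynomial (B.transpose * B) := by
      apply wordCoeff_injective
      rw [map_smul]
      exact hBt
    rcases eq_or_lt_of_le (show 0 ≤ t from ht) with rfl | ht
    · rw [zero_smul] at hBt'
      have hB1 : (B.transpose * B).trace = 1 := hB
      simp [eq_zero_of_gramPolynomial_eq_zero hBt'.symm] at hB1
    · apply hf
      have hs : f = ∑ i, star (Real.sqrt t⁻¹ • ∑ u, B i u • wordMonomial u.1)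
          * (Real.sqrt t⁻¹ • ∑ u, B i u • wordMonomial u.1) := by
        simp only [star_smul_freeAlgebra, smul_mul_smul_comm,
          Real.mul_self_sqrt (inv_nonneg.mpr ht.le), ← Finset.smul_sum]
        rw [← gramPolynomial_transpose_mul_self, ← hBt', smul_smul, inv_mul_cancel₀ ht.ne',
          one_smul]
      rw [hs]
      exact isHermitianSOS_sum _
  obtain ⟨l, v, u, hlT, hvu, hlS⟩ :=
    geometric_hahn_banach_closed_compact hTconvex hTclosed hconvex hcompact hdisj.symm
  have hv : 0 < v := by simpa using hlT _ ⟨0, Set.self_mem_Ici, rfl⟩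
  have hlf : l (wordCoeff f) ≤ 0 := by
    by_contra! hpos
    have := hlT _ ⟨v / l (wordCoeff f), (div_pos hv hpos).le, rfl⟩
    simp only [map_smul, smul_eq_mul] at this
    rw [div_mul_cancel₀ _ hpos.ne'] at this
    exact lt_irrefl _ this
  obtain ⟨w, hw⟩ := Function.ne_iff.mp hf0
  rw [Pi.zero_apply] at hw
  let M : (FreeMonoid (Fin g) → ℝ) →ₗ[ℝ] ℝ := wordCoeff f w • LinearMap.proj w
  have hM : Continuous M := continuous_const.mul (continuous_apply w)
  obtain ⟨b, hb⟩ := hcompact.exists_bound_of_continuousOn hM.continuousOn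
  have hb0 : 0 < |b| + 1 := by positivity
  refine ⟨(l.toLinearMap - (v / (|b| + 1)) • M) ∘ₗ wordCoeff, ?_, ?_⟩
  · have : 0 < v / (|b| + 1) * (wordCoeff f w * wordCoeff f w) :=
      mul_pos (div_pos hv hb0) (mul_self_pos.mpr hw)
    simp [M]
    linarith
  · intro B hB
    have h1 := hlS _ ⟨B, hB, rfl⟩
    have h2 := (le_abs_self _).trans ((hb _ ⟨B, hB, rfl⟩).trans (le_abs_self b))
    have h3 : v / (|b| + 1) * M (Φ B) ≤ v := by
      calc v / (|b| + 1) * M (Φ B) ≤ v / (|b| + 1) * (|b| + 1) :=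
            mul_le_mul_of_nonneg_left (by linarith) (div_pos hv hb0).le
        _ = v := div_mul_cancel₀ _ hb0.ne'
    change 0 < l (Φ B) - v / (|b| + 1) * M (Φ B)
    linarith

end Separation

section GelfandNaimarkSegal

variable {g : ℕ}

/-- The involution of the free algebra as a linear map. -/
def starLinear : FreeAlgebra ℝ (Fin g) →ₗ[ℝ] FreeAlgebra ℝ (Fin g) where
  toFun := star
  map_add' := star_add
  map_smul' := star_smul_freeAlgebra

lemma star_gramPolynomial_transpose_mul_self {d : ℕ}
    (B : Matrix (ShortWord g d) (ShortWord g d) ℝ) :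
    star (gramPolynomial (B.transpose * B)) = gramPolynomial (B.transpose * B) := by
  simp [gramPolynomial_transpose_mul_self]

/-- A free polynomial which is not a sum of squares is negative at a symmetric functional which is
strictly positive on squares of polynomials of degree at most `d`. -/
lemma exists_symmetric_separating_functional {f : FreeAlgebra ℝ (Fin g)} (hsym : star f = f)
    (hf : ¬ IsHermitianSOS f) (d : ℕ) :
    ∃ L : FreeAlgebra ℝ (Fin g) →ₗ[ℝ] ℝ, L f < 0 ∧ (∀ p, L (star p) = L p) ∧
      (Matrix.of fun u v : ShortWord g d => L (star (wordMonomial u.1) * wordMonomial v.1)).PosDef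
      := by
  obtain ⟨L, hLf, hL⟩ := exists_separating_functional hf d
  have hstar : ∀ p, (L + L ∘ₗ starLinear) (star p) = (L + L ∘ₗ starLinear) p := by
    intro p
    simp [starLinear, add_comm]
  refine ⟨L + L ∘ₗ starLinear, ?_, hstar, ?_⟩
  · simp [starLinear, hsym, hLf]
  · refine Matrix.posDef_iff_dotProduct_mulVec.mpr ⟨?_, fun x hx => ?_⟩
    · ext u v
      rw [Matrix.conjTranspose_apply, Matrix.of_apply, Matrix.of_apply, ← hstar, star_mul,
        star_star]
      rfl
    · let e : ShortWord g d := ⟨1, Nat.zero_le d⟩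
      have ht : 0 < x ⬝ᵥ x := by
        rw [← star_trivial x]
        exact Matrix.dotProduct_star_self_pos_iff.mpr hx
      let s := (Real.sqrt (x ⬝ᵥ x))⁻¹
      have hs : s * s = (x ⬝ᵥ x)⁻¹ := by
        rw [← mul_inv, Real.mul_self_sqrt ht.le]
      let B : Matrix (ShortWord g d) (ShortWord g d) ℝ :=
        Matrix.of fun i v => if i = e then s * x v else 0
      have hB : ∀ u v, (B.transpose * B) u v = (x ⬝ᵥ x)⁻¹ * (x u * x v) := by
        intro u v
        rw [Matrix.mul_apply, Finset.sum_eq_single e]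
        · simp only [B, Matrix.transpose_apply, Matrix.of_apply, if_true, ← hs]
          ring
        · intro i _ hi
          simp [B, hi]
        · simp
      have htr : (B.transpose * B).trace = 1 := by
        simp only [Matrix.trace, Matrix.diag, hB, ← Finset.mul_sum]
        exact inv_mul_cancel₀ ht.ne'
      have hpos : 0 < (L + L ∘ₗ starLinear) (gramPolynomial (B.transpose * B)) := by
        have := hL B htr
        simp only [LinearMap.add_apply, LinearMap.comp_apply]
        change 0 < _ + L (star _)
        rw [star_gramPolynomial_transpose_mul_self]
        linarith
      have hval : (L + L ∘ₗ starLinear) (gramPolynomial (B.transpose * B)) = (x ⬝ᵥ x)⁻¹ *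
          (star x ⬝ᵥ (Matrix.of fun u v : ShortWord g d => (L + L ∘ₗ starLinear)
            (star (wordMonomial u.1) * wordMonomial v.1)).mulVec x) := by
        simp only [gramPolynomial_apply, map_sum, map_smul, hB, dotProduct, Matrix.mulVec,
          Finset.mul_sum, Matrix.of_apply, star_trivial, smul_eq_mul]
        exact Finset.sum_congr rfl fun u _ => Finset.sum_congr rfl fun v _ => by ring
      rw [hval] at hpos
      exact pos_of_mul_pos_right hpos (inv_pos.mpr ht).le

/-- Helton's theorem: a symmetric free polynomial which is not a sum of squares fails to be
positive semidefinite at some tuple of real symmetric matrices. -/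
theorem exists_isSymm_dotProduct_evalMat_neg {f : FreeAlgebra ℝ (Fin g)} (hsym : star f = f)
    (hf : ¬ IsHermitianSOS f) :
    ∃ (ι : Type) (_ : Fintype ι) (_ : DecidableEq ι) (X : Fin g → Matrix ι ι ℝ) (ξ : ι → ℝ),
      (∀ j, (X j).IsSymm) ∧ ξ ⬝ᵥ (evalMat f X).mulVec ξ < 0 := by
  let d := (wordSupport f).sup FreeMonoid.length
  have hd : ∀ w ∈ wordSupport f, w.length ≤ 2 * d := fun w hw =>
    (Finset.le_sup (f := FreeMonoid.length) hw).trans (Nat.le_mul_of_pos_left _ two_pos)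
  obtain ⟨L, hLf, hstar, hpos⟩ := exists_symmetric_separating_functional hsym hf d
  obtain ⟨Q, hQ⟩ := posSemidef_iff_eq_transpose_mul_self.mp hpos.posSemidef
  have hQdet : IsUnit Q.det := by
    have := hpos.det_pos.ne'
    rw [hQ, Matrix.det_mul] at this
    exact (right_ne_zero_of_mul this).isUnit
  have hM : ∀ u v : ShortWord g d, (Q.transpose * Q) u v
      = L (star (wordMonomial u.1) * wordMonomial v.1) := fun u v => by rw [← hQ]; rfl
  let H : Fin g → Matrix (ShortWord g d) (ShortWord g d) ℝ := fun j => Matrix.of fun u v =>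
    L (star (wordMonomial u.1) * wordMonomial (FreeMonoid.of j * v.1))
  let X : Fin g → Matrix (ShortWord g d) (ShortWord g d) ℝ := fun j =>
    Q⁻¹.transpose * H j * Q⁻¹
  have hH : ∀ j, (H j).transpose = H j := by
    intro j
    ext u v
    simp only [H, Matrix.transpose_apply, Matrix.of_apply]
    rw [← hstar]
    simp only [wordMonomial_mul, star_mul, star_star, star_wordMonomial, FreeMonoid.star_of,
      mul_assoc]
  have hX : ∀ j, (X j).transpose = X j := by
    intro j
    simp only [X, Matrix.transpose_mul, Matrix.transpose_transpose, hH, Matrix.mul_assoc]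
  let e : ShortWord g d := ⟨1, Nat.zero_le d⟩
  have hword : ∀ (w : FreeMonoid (Fin g)) (hw : w.length ≤ d),
      (FreeMonoid.lift X w).mulVec (Q.col e) = Q.col ⟨w, hw⟩ := by
    intro w
    induction w using FreeMonoid.inductionOn' with
    | one => intro _; simp [e]
    | of_mul j w ih =>
      intro hw
      have hw' : w.length ≤ d := by
        rw [FreeMonoid.length_mul] at hw
        omega
      rw [map_mul, ← Matrix.mulVec_mulVec, ih hw', FreeMonoid.lift_eval_of]
      have hcol : (H j).mulVec (Pi.single ⟨w, hw'⟩ 1)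
          = (Q.transpose * Q).mulVec (Pi.single ⟨FreeMonoid.of j * w, hw⟩ 1) := by
        ext u
        simp [H, hM]
      rw [← Matrix.mulVec_single_one, ← Matrix.mulVec_single_one, Matrix.mulVec_mulVec]
      simp only [X]
      rw [Matrix.mul_assoc, Matrix.nonsing_inv_mul _ hQdet, Matrix.mul_one,
        ← Matrix.mulVec_mulVec, hcol, ← Matrix.mulVec_mulVec, Matrix.mulVec_mulVec,
        ← Matrix.transpose_mul, Matrix.mul_nonsing_inv _ hQdet, Matrix.transpose_one,
        Matrix.one_mulVec]
  refine ⟨ShortWord g d, inferInstance, inferInstance, X, Q.col e, hX, ?_⟩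
  suffices h : Q.col e ⬝ᵥ (evalMat f X).mulVec (Q.col e) = L f by rwa [h]
  conv_rhs => rw [sum_wordCoeff_smul f]
  rw [evalMat_eq_sum, Matrix.sum_mulVec, dotProduct_sum, map_sum]
  refine Finset.sum_congr rfl fun w hw => ?_
  rw [Matrix.smul_mulVec, dotProduct_smul, map_smul]
  congr 1
  obtain ⟨u, v, hu, hv, rfl⟩ : ∃ u v : FreeMonoid (Fin g),
      u.length ≤ d ∧ v.length ≤ d ∧ w = star u * v := by
    refine ⟨star (FreeMonoid.ofList (w.toList.take d)), FreeMonoid.ofList (w.toList.drop d),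
      ?_, ?_, ?_⟩
    · rw [length_star]
      exact List.length_take_le _ _
    · have h1 := hd w hw
      have h2 : (FreeMonoid.ofList (w.toList.drop d)).length = w.length - d := List.length_drop
      omega
    · rw [star_star]
      exact (List.take_append_drop d w.toList).symm
  have hstarX : FreeMonoid.lift X (star u) = (FreeMonoid.lift X u).transpose := by
    rw [← evalMat_wordMonomial, ← star_wordMonomial, evalMat_star]
    simp only [hX, evalMat_wordMonomial]
  rw [map_mul, hstarX, ← Matrix.mulVec_mulVec, Matrix.dotProduct_mulVec, Matrix.vecMul_transpose,
    hword u hu, hword v hv, wordMonomial_mul, ← star_wordMonomial]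
  exact hM ⟨u, hu⟩ ⟨v, hv⟩

end GelfandNaimarkSegal

section CommonSize

open scoped Kronecker

variable {g : ℕ} {ι κ : Type} [Fintype ι] [DecidableEq ι] [Fintype κ] [DecidableEq κ]

lemma evalMat_kronecker_one (p : FreeAlgebra ℝ (Fin g)) (X : Fin g → Matrix ι ι ℝ) :
    evalMat p (fun j => X j ⊗ₖ (1 : Matrix κ κ ℝ)) = evalMat p X ⊗ₖ (1 : Matrix κ κ ℝ) := by
  induction p using FreeAlgebra.induction with
  | grade0 r => simp [evalMat, Algebra.algebraMap_eq_smul_one, Matrix.smul_kronecker]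
  | grade1 x => simp [evalMat]
  | mul a b ha hb => rw [evalMat_mul, evalMat_mul, ha, hb, ← Matrix.mul_kronecker_mul, one_mul]
  | add a b ha hb =>
    simp only [evalMat, map_add, Matrix.add_kronecker] at *
    rw [ha, hb]

lemma evalMat_one_kronecker (p : FreeAlgebra ℝ (Fin g)) (X : Fin g → Matrix κ κ ℝ) :
    evalMat p (fun j => (1 : Matrix ι ι ℝ) ⊗ₖ X j) = (1 : Matrix ι ι ℝ) ⊗ₖ evalMat p X := by
  induction p using FreeAlgebra.induction with
  | grade0 r => simp [evalMat, Algebra.algebraMap_eq_smul_one, Matrix.kronecker_smul]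
  | grade1 x => simp [evalMat]
  | mul a b ha hb => rw [evalMat_mul, evalMat_mul, ha, hb, ← Matrix.mul_kronecker_mul, one_mul]
  | add a b ha hb =>
    simp only [evalMat, map_add, Matrix.kronecker_add] at *
    rw [ha, hb]

/-- A symmetric matrix with a positive value of its quadratic form has a positive eigenvalue. -/
lemma hasPosEigenvalue_of_dotProduct_pos {n : ℕ} {M : Matrix (Fin n) (Fin n) ℝ} (hM : M.IsSymm)
    {v : Fin n → ℝ} (hv : 0 < v ⬝ᵥ M.mulVec v) : HasPosEigenvalue M := by
  have hH : (-M).IsHermitian := by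
    rw [Matrix.IsHermitian, Matrix.conjTranspose_eq_transpose_of_trivial, Matrix.transpose_neg, hM]
  by_contra hno
  have hpsd : (-M).PosSemidef := by
    refine hH.posSemidef_iff_eigenvalues_nonneg.mpr fun i => ?_
    by_contra hi
    refine hno ⟨-hH.eigenvalues i, hH.eigenvectorBasis i, by simpa using hi, ?_, ?_⟩
    · intro h0
      exact hH.eigenvectorBasis.orthonormal.ne_zero i (WithLp.ofLp_injective 2 h0)
    · have := hH.mulVec_eigenvectorBasis i
      rw [Matrix.neg_mulVec] at this
      rw [neg_smul, ← this, neg_neg]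
  have := hpsd.dotProduct_mulVec_nonneg v
  rw [star_trivial, Matrix.neg_mulVec, dotProduct_neg] at this
  linarith

/-- Amplification by tensor products brings the two tuples to the same size. -/
lemma exists_common_size (p q : FreeAlgebra ℝ (Fin g)) {X : Fin g → Matrix ι ι ℝ} {v : ι → ℝ}
    (hX : ∀ j, (X j).IsSymm) (hv : 0 < v ⬝ᵥ (evalMat p X).mulVec v) [Nonempty κ]
    {Z : Fin g → Matrix κ κ ℝ} (hZ : ∀ j, (Z j).IsSymm) (hq : (evalMat q Z).det ≠ 0) :
    ∃ (n : ℕ) (X' Z' : Fin g → Matrix (Fin n) (Fin n) ℝ) (v' : Fin n → ℝ), 0 < n ∧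
      (∀ j, (X' j).IsSymm) ∧ (∀ j, (Z' j).IsSymm) ∧ 0 < v' ⬝ᵥ (evalMat p X').mulVec v' ∧
      (evalMat q Z').det ≠ 0 := by
  have hι : Nonempty ι := by
    by_contra h
    rw [not_nonempty_iff] at h
    simp at hv
  let e := Fintype.equivFin (ι × κ)
  obtain ⟨k⟩ := ‹Nonempty κ›
  let w : ι × κ → ℝ := fun a => v a.1 * (Pi.single k 1 : κ → ℝ) a.2
  refine ⟨Fintype.card (ι × κ), fun j => Matrix.reindex e e (X j ⊗ₖ 1),
    fun j => Matrix.reindex e e (1 ⊗ₖ Z j), w ∘ e.symm, Fintype.card_pos_iff.mpr inferInstance,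
    fun j => ?_, fun j => ?_, ?_, ?_⟩
  · rw [Matrix.IsSymm, Matrix.transpose_reindex, ← Matrix.kroneckerMap_transpose, hX j,
      Matrix.transpose_one]
  · rw [Matrix.IsSymm, Matrix.transpose_reindex, ← Matrix.kroneckerMap_transpose, hZ j,
      Matrix.transpose_one]
  · rw [evalMat_reindex, evalMat_kronecker_one, Matrix.reindex_apply, Matrix.submatrix_mulVec_equiv,
      Function.comp_assoc, e.symm_symm, e.symm_comp_self, Function.comp_id,
      comp_equiv_dotProduct_comp_equiv]
    convert hv using 1
    simp [w, dotProduct, Matrix.mulVec, Fintype.sum_prod_type, Pi.single_apply, Matrix.one_apply]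
  · rw [evalMat_reindex, evalMat_one_kronecker, Matrix.det_reindex_self, Matrix.det_kronecker,
      Matrix.det_one, one_pow, one_mul]
    exact pow_ne_zero _ hq

end CommonSize

/-- if `-p` is not a hermitian sum of squares and `det (q(X)) = 0` for every `n`
and every `X ∈ K(n)`, then `q = 0`. -/
theorem stmt_8 (g : ℕ) (p q : FreeAlgebra ℝ (Fin g)) (hsym : star p = p)
    (hnsos : ¬ IsHermitianSOS (-p))
    (hdet : ∀ n : ℕ, 0 < n → ∀ X : Fin g → Matrix (Fin n) (Fin n) ℝ,
      (∀ j, (X j).IsSymm) → HasPosEigenvalue (evalMat p X) → (evalMat q X).det = 0) :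
    q = 0 := by
  by_contra hq
  obtain ⟨ι, _, _, X₀, v₀, hX₀, hv₀⟩ :=
    exists_isSymm_dotProduct_evalMat_neg (f := -p) (by rw [star_neg, hsym]) hnsos
  obtain ⟨κ, _, _, _, Z₀, hZ₀, hq₀⟩ := exists_isSymm_det_evalMat_ne_zero hq
  have hp₀ : 0 < v₀ ⬝ᵥ (evalMat p X₀).mulVec v₀ := by
    have hneg : evalMat (-p) X₀ = -evalMat p X₀ := map_neg _ _
    rw [hneg, Matrix.neg_mulVec, dotProduct_neg] at hv₀
    linarith
  obtain ⟨n, X, Z, v, hn, hX, hZ, hv, hqZ⟩ := exists_common_size p q hX₀ hp₀ hZ₀ hq₀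
  let Y : ℝ → Fin g → Matrix (Fin n) (Fin n) ℝ := fun t j => X j + t • (Z j - X j)
  have hY : ∀ t j, (Y t j).IsSymm := fun t j => (hX j).add (((hZ j).sub (hX j)).smul t)
  have hpY : ∀ t, (evalMat p (Y t)).IsSymm := by
    intro t
    have h := evalMat_star p (Y t)
    rw [hsym, funext fun j => (hY t j).eq] at h
    exact h.symm
  have hcont : Continuous fun t : ℝ => v ⬝ᵥ (evalMat p (Y t)).mulVec v := by
    have hYc : Continuous Y := by fun_prop
    exact continuous_const.dotProduct (((continuous_evalMat p).comp hYc).matrix_mulVec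
      continuous_const)
  have hnear : ∀ᶠ t in nhds (0 : ℝ), 0 < v ⬝ᵥ (evalMat p (Y t)).mulVec v :=
    hcont.continuousAt.eventually_const_lt (by simpa [Y] using hv)
  obtain ⟨P, hP⟩ := exists_polynomial_det_evalMat q X fun j => Z j - X j
  have hP0 : P = 0 := by
    refine P.eq_zero_of_infinite_isRoot (infinite_of_mem_nhds 0 ?_)
    filter_upwards [hnear] with t ht
    change P.eval t = 0
    rw [hP]
    exact hdet n hn (Y t) (hY t) (hasPosEigenvalue_of_dotProduct_pos (hpY t) ht)
  have h1 := hP 1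
  simp only [hP0, Polynomial.eval_zero, one_smul, add_sub_cancel] at h1
  exact hqZ h1.symm
end
end

section
/- Let p ∈ ℝ⟨x⟩ be symmetric and suppose −p is not a hermitian sum of squares. For each n, let K̂(n) denote the set of pairs (X, v) where X ∈ 𝕊ₙ(ℝ^g), v ∈ ℝⁿ is nonzero, and v is an eigenvector of p(X) corresponding to a positive eigenvalue. If q ∈ ℝ⟨x⟩ satisfies q(X)v = 0 for every positive integer n and every (X, v) ∈ K̂(n), then q = 0. -/
open scoped BigOperators

noncomputable section

namespace FreePoly

open FreeAlgebra Matrix Filter Topology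

variable {g : ℕ}

/-- The monomial attached to a word. -/
abbrev mon (w : FreeMonoid (Fin g)) : FreeAlgebra ℝ (Fin g) :=
  basisFreeMonoid ℝ (Fin g) w

/-- The coefficients of a free polynomial. -/
abbrev coef (f : FreeAlgebra ℝ (Fin g)) : FreeMonoid (Fin g) →₀ ℝ :=
  (basisFreeMonoid ℝ (Fin g)).repr f

lemma mon_eq (w : FreeMonoid (Fin g)) : mon w = FreeMonoid.lift (ι ℝ) w := by
  simp [mon, basisFreeMonoid, equivMonoidAlgebraFreeMonoid]

lemma mon_one : mon (1 : FreeMonoid (Fin g)) = 1 := by simp [mon_eq]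

lemma mon_mul (u v : FreeMonoid (Fin g)) : mon (u * v) = mon u * mon v := by simp [mon_eq]

lemma mon_of (j : Fin g) : mon (FreeMonoid.of j) = ι ℝ j := by simp [mon_eq]

lemma star_mon (w : FreeMonoid (Fin g)) : star (mon w) = mon (star w) := by
  induction w using FreeMonoid.recOn with
  | one => simp [mon_one]
  | of_mul j w ih =>
    rw [mon_mul, star_mul, mon_of, star_ι, ih, star_mul, mon_mul, FreeMonoid.star_of, mon_of]

lemma star_smul_real (r : ℝ) (f : FreeAlgebra ℝ (Fin g)) : star (r • f) = r • star f := by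
  rw [Algebra.smul_def, star_mul, star_algebraMap, Algebra.smul_def, Algebra.commutes]

lemma length_star (w : FreeMonoid (Fin g)) : (star w).length = w.length :=
  List.length_reverse

lemma eq_of_mul_eq_mul_of_length {u v u' v' : FreeMonoid (Fin g)} (h : u * v = u' * v')
    (hl : u.length = u'.length) : u = u' ∧ v = v' :=
  List.append_inj h hl

lemma eq_sum_mon (f : FreeAlgebra ℝ (Fin g)) : f = ∑ w ∈ (coef f).support, coef f w • mon w :=
  ((basisFreeMonoid ℝ (Fin g)).linearCombination_repr f).symm

/-- The leading coefficients of `f* f` are squares. -/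
lemma coef_star_mul_self (f : FreeAlgebra ℝ (Fin g)) (l : FreeMonoid (Fin g))
    (hl : ∀ w, coef f w ≠ 0 → w.length ≤ l.length) :
    coef (star f * f) (star l * l) = coef f l ^ 2 := by
  classical
  have h1 : star f * f = ∑ u ∈ (coef f).support, ∑ v ∈ (coef f).support,
      (coef f u * coef f v) • mon (star u * v) := by
    conv_lhs => rw [eq_sum_mon f]
    simp only [star_sum, Finset.sum_mul_sum, star_smul_real, star_mon, smul_mul_smul_comm, mon_mul]
  rw [h1]
  simp only [coef, map_sum, map_smul, Finsupp.coe_finsetSum, Finset.sum_apply, Finsupp.smul_apply,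
    Module.Basis.repr_self, smul_eq_mul]
  have key : ∀ u ∈ (coef f).support, ∀ v ∈ (coef f).support,
      star u * v = star l * l → u = l ∧ v = l := by
    intro u hu v hv h
    have hu := hl u (by simpa using hu)
    have hv := hl v (by simpa using hv)
    have hlen := congrArg FreeMonoid.length h
    simp only [FreeMonoid.length_mul, length_star] at hlen
    obtain ⟨h1, h2⟩ := eq_of_mul_eq_mul_of_length h (by rw [length_star, length_star]; omega)
    exact ⟨star_injective h1, h2⟩
  by_cases hc : coef f l = 0
  · rw [hc]
    rw [Finset.sum_eq_zero]; · simp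
    intro u hu
    refine Finset.sum_eq_zero fun v hv => ?_
    rw [Finsupp.single_apply, if_neg, mul_zero]
    intro h
    obtain ⟨rfl, _⟩ := key u hu v hv h
    simp at hu; exact hu hc
  · have hm : l ∈ (coef f).support := by simpa using hc
    rw [Finset.sum_eq_single_of_mem l hm, Finset.sum_eq_single_of_mem l hm]
    · simp [pow_two]
    · intro v hv hne
      rw [Finsupp.single_apply, if_neg, mul_zero]
      exact fun h => hne (key l hm v hv h).2
    · intro u hu hne
      refine Finset.sum_eq_zero fun v hv => ?_
      rw [Finsupp.single_apply, if_neg, mul_zero]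
      exact fun h => hne (key u hu v hv h).1

lemma eq_zero_of_sum_star_mul_self_eq_zero {κ : Type*} [Fintype κ]
    (h : κ → FreeAlgebra ℝ (Fin g)) (h0 : ∑ i, star (h i) * h i = 0) (i : κ) : h i = 0 := by
  classical
  by_contra hi
  let S : Finset (FreeMonoid (Fin g)) := Finset.univ.biUnion fun i => (coef (h i)).support
  have hmem : ∀ i w, coef (h i) w ≠ 0 → w ∈ S := fun i w hw => by
    simp only [S, Finset.mem_biUnion, Finset.mem_univ, true_and]; exact ⟨i, by simpa using hw⟩
  obtain ⟨w, hw⟩ : ∃ w, coef (h i) w ≠ 0 := by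
    by_contra! hc
    exact hi ((basisFreeMonoid ℝ (Fin g)).repr.map_eq_zero_iff.1 (Finsupp.ext hc))
  obtain ⟨l, hlS, hl⟩ := S.exists_max_image FreeMonoid.length ⟨w, hmem i w hw⟩
  have h1 : ∑ i, coef (h i) l ^ 2 = 0 := by
    rw [← Finset.sum_congr rfl fun i _ => coef_star_mul_self (h i) l
      fun w hw => hl w (hmem i w hw)]
    rw [← Finset.sum_apply', ← map_sum, h0]; simp
  have h2 : ∀ i, coef (h i) l = 0 := fun i => by
    have := (Finset.sum_eq_zero_iff_of_nonneg fun i _ => sq_nonneg _).1 h1 i (Finset.mem_univ i)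
    exact pow_eq_zero_iff (two_ne_zero) |>.1 this
  simp only [S, Finset.mem_biUnion, Finset.mem_univ, true_and] at hlS
  obtain ⟨i, hi⟩ := hlS
  exact (by simpa using hi : coef (h i) l ≠ 0) (h2 i)

/-- The entries of a real positive semidefinite matrix of trace at most one are bounded by one. -/
lemma abs_entry_le_one {ω : Type*} [Fintype ω] [DecidableEq ω] {G : Matrix ω ω ℝ}
    (hG : G.PosSemidef) (ht : G.trace ≤ 1) (u v : ω) : |G u v| ≤ 1 := by
  have hd : ∀ u, 0 ≤ G u u := fun u => hG.diag_nonneg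
  have hle : ∀ u, G u u ≤ 1 := fun u =>
    (Finset.single_le_sum (f := fun u => G u u) (fun u _ => hd u) (Finset.mem_univ u)).trans ht
  have hsymm : G v u = G u v := by simpa using hG.isHermitian.apply u v
  have h1 := hG.dotProduct_mulVec_nonneg (Pi.single u 1 + Pi.single v 1)
  have h2 := hG.dotProduct_mulVec_nonneg (Pi.single u 1 - Pi.single v 1)
  simp [Matrix.mulVec_add, Matrix.mulVec_sub, hsymm] at h1 h2
  rw [abs_le]
  constructor <;> linarith [hle u, hle v]

lemma isCompact_posSemidef_trace {ω : Type*} [Fintype ω] [DecidableEq ω] :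
    IsCompact {x : Matrix ω ω ℝ × ℝ | x.1.PosSemidef ∧ 0 ≤ x.2 ∧ x.1.trace + x.2 = 1} := by
  have hK : IsCompact ((Set.univ.pi fun _ : ω => Set.univ.pi fun _ : ω => Set.Icc (-1 : ℝ) 1) ×ˢ
      Set.Icc (-1 : ℝ) 1 : Set (Matrix ω ω ℝ × ℝ)) :=
    (isCompact_univ_pi fun _ => isCompact_univ_pi fun _ => isCompact_Icc).prod isCompact_Icc
  refine hK.of_isClosed_subset ?_ ?_
  · have : {x : Matrix ω ω ℝ × ℝ | x.1.PosSemidef ∧ 0 ≤ x.2 ∧ x.1.trace + x.2 = 1} =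
        {x | x.1ᴴ = x.1} ∩ (⋂ c : ω → ℝ, {x | 0 ≤ star c ⬝ᵥ (x.1 *ᵥ c)}) ∩ {x | 0 ≤ x.2} ∩
          {x | x.1.trace + x.2 = 1} := by
      ext x
      simp only [posSemidef_iff_dotProduct_mulVec, IsHermitian, Set.mem_ofPred_eq, Set.mem_inter_iff,
        Set.mem_iInter]
      tauto
    rw [this]
    refine (((isClosed_eq ?_ ?_).inter (isClosed_iInter fun c => isClosed_le ?_ ?_)).inter
      (isClosed_le ?_ ?_)).inter (isClosed_eq ?_ ?_)
    all_goals fun_prop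
  · intro x hx
    obtain ⟨hG, hβ, ht⟩ : Matrix.PosSemidef x.1 ∧ 0 ≤ x.2 ∧ Matrix.trace x.1 + x.2 = 1 := hx
    have h0 : 0 ≤ Matrix.trace x.1 := hG.trace_nonneg
    exact ⟨fun u _ v _ => abs_le.1 (abs_entry_le_one hG (by linarith) u v), by linarith,
      by linarith⟩

lemma convex_posSemidef_trace {ω : Type*} [Fintype ω] [DecidableEq ω] :
    Convex ℝ {x : Matrix ω ω ℝ × ℝ | x.1.PosSemidef ∧ 0 ≤ x.2 ∧ x.1.trace + x.2 = 1} := by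
  rintro ⟨G, β⟩ ⟨hG, hβ, ht⟩ ⟨G', β'⟩ ⟨hG', hβ', ht'⟩ a b ha hb hab
  dsimp only at *
  refine ⟨(hG.smul ha).add (hG'.smul hb), ?_, ?_⟩
  · simp; positivity
  · simp; linear_combination a * ht + b * ht' + hab

lemma exists_eq_transpose_mul_self {ω : Type*} [Fintype ω] [DecidableEq ω] {G : Matrix ω ω ℝ}
    (hG : G.PosSemidef) : ∃ B : Matrix ω ω ℝ, G = Bᵀ * B := by
  open scoped MatrixOrder in
  obtain ⟨B, hB, -, hBG⟩ := sub_zero G ▸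
    CFC.exists_sqrt_of_isSelfAdjoint_of_quasispectrumRestricts hG.isHermitian
      (QuasispectrumRestricts.nnreal_of_nonneg hG.nonneg)
  refine ⟨B, ?_⟩
  have : Bᵀ = B := by simpa [star_eq_conjTranspose] using hB.star_eq
  rw [this, hBG, sub_zero]

/-- The polynomial with Gram matrix `G` with respect to a family of words. -/
def gram {ω : Type*} [Fintype ω] (w : ω → FreeMonoid (Fin g)) :
    Matrix ω ω ℝ →ₗ[ℝ] FreeAlgebra ℝ (Fin g) where
  toFun G := ∑ u, ∑ v, G u v • (star (mon (w u)) * mon (w v))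
  map_add' G G' := by simp [add_smul, Finset.sum_add_distrib]
  map_smul' r G := by simp [mul_smul, Finset.smul_sum]

lemma gram_apply {ω : Type*} [Fintype ω] (w : ω → FreeMonoid (Fin g))
    (G : Matrix ω ω ℝ) : gram w G = ∑ u, ∑ v, G u v • (star (mon (w u)) * mon (w v)) := rfl

lemma star_mul_sum_mon {ω : Type*} [Fintype ω] (w : ω → FreeMonoid (Fin g))
    (c : ω → ℝ) :
    star (∑ u, c u • mon (w u)) * ∑ u, c u • mon (w u) = gram w (vecMulVec c c) := by
  simp only [gram_apply, star_sum, Finset.sum_mul_sum, star_smul_real, smul_mul_smul_comm,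
    vecMulVec_apply]

lemma gram_transpose_mul_self {ω : Type*} [Fintype ω] (w : ω → FreeMonoid (Fin g))
    (B : Matrix ω ω ℝ) : gram w (Bᵀ * B) =
      ∑ i, star (∑ u, B i u • mon (w u)) * ∑ u, B i u • mon (w u) := by
  simp_rw [star_mul_sum_mon, ← map_sum]
  congr 1
  ext u v
  simp [Matrix.mul_apply, Matrix.sum_apply, vecMulVec_apply]

lemma isHermitianSOS_sum {κ : Type*} [Fintype κ] (h : κ → FreeAlgebra ℝ (Fin g)) :
    IsHermitianSOS (∑ i, star (h i) * h i) :=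
  ⟨Fintype.card κ, h ∘ (Fintype.equivFin κ).symm,
    (Equiv.sum_comp (Fintype.equivFin κ).symm fun i => star (h i) * h i).symm⟩

/-- If `-p` is not a sum of squares then no nontrivial nonnegative combination of squares
and `p` vanishes. -/
lemma gram_add_smul_ne_zero {ω : Type*} [Fintype ω] [DecidableEq ω]
    {w : ω → FreeMonoid (Fin g)} (hw : Function.Injective w) {p : FreeAlgebra ℝ (Fin g)}
    (hp : ¬ IsHermitianSOS (-p)) {G : Matrix ω ω ℝ} {β : ℝ} (hG : G.PosSemidef) (hβ : 0 ≤ β)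
    (ht : G.trace + β = 1) : gram w G + β • p ≠ 0 := by
  intro h0
  rcases hβ.eq_or_lt with rfl | hβ
  · obtain ⟨B, rfl⟩ := exists_eq_transpose_mul_self hG
    rw [zero_smul, add_zero, gram_transpose_mul_self] at h0
    have hB : B = 0 := by
      ext i u
      have h1 := eq_zero_of_sum_star_mul_self_eq_zero _ h0 i
      have hli : LinearIndependent ℝ (fun u => mon (w u)) :=
        (basisFreeMonoid ℝ (Fin g)).linearIndependent.comp w hw
      exact Fintype.linearIndependent_iff.1 hli _ h1 u
    simp [hB] at ht
  · refine hp ?_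
    obtain ⟨B, hB⟩ := exists_eq_transpose_mul_self (hG.smul (inv_nonneg.2 hβ.le))
    have : -p = gram w (β⁻¹ • G) := by
      rw [map_smul, eq_neg_of_add_eq_zero_left h0, smul_neg, inv_smul_smul₀ hβ.ne']
    rw [this, hB, gram_transpose_mul_self]
    exact isHermitianSOS_sum _

/-- Separation of `-p` from the cone of sums of squares. -/
lemma exists_positive_functional {ω : Type*} [Fintype ω]
    {w : ω → FreeMonoid (Fin g)} (hw : Function.Injective w) {p : FreeAlgebra ℝ (Fin g)}
    (hsym : star p = p) (hp : ¬ IsHermitianSOS (-p)) :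
    ∃ L : FreeAlgebra ℝ (Fin g) →ₗ[ℝ] ℝ, (∀ f, L (star f) = L f) ∧ 0 < L p ∧
      ∀ f ∈ Submodule.span ℝ (Set.range fun u => mon (w u)), f ≠ 0 → 0 < L (star f * f) := by
  classical
  let R : FreeAlgebra ℝ (Fin g) →ₗ[ℝ] (FreeMonoid (Fin g) → ℝ) :=
    Finsupp.lcoeFun ∘ₗ (basisFreeMonoid ℝ (Fin g)).repr.toLinearMap
  have hR : Function.Injective R :=
    DFunLike.coe_injective.comp (basisFreeMonoid ℝ (Fin g)).repr.injective
  let T : Matrix ω ω ℝ × ℝ →ₗ[ℝ] FreeAlgebra ℝ (Fin g) :=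
    (gram w).coprod (LinearMap.toSpanSingleton ℝ _ p)
  have hT : ∀ G β, T (G, β) = gram w G + β • p := fun G β => by simp [T]
  let D : Set (Matrix ω ω ℝ × ℝ) := {x | x.1.PosSemidef ∧ 0 ≤ x.2 ∧ x.1.trace + x.2 = 1}
  have hcont : Continuous (R ∘ₗ T) := LinearMap.continuous_of_finiteDimensional _
  have hcpt : IsCompact ((R ∘ₗ T) '' D) := isCompact_posSemidef_trace.image hcont
  have hconv : Convex ℝ ((R ∘ₗ T) '' D) := convex_posSemidef_trace.linear_image _
  have h0 : (0 : FreeMonoid (Fin g) → ℝ) ∉ (R ∘ₗ T) '' D := by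
    rintro ⟨⟨G, β⟩, ⟨hG, hβ, ht⟩, h⟩
    refine gram_add_smul_ne_zero hw hp hG hβ ht ?_
    rw [← hT]
    exact hR (h.trans (map_zero R).symm)
  obtain ⟨φ, c, hc, hφ⟩ := geometric_hahn_banach_point_closed hconv hcpt.isClosed h0
  rw [map_zero] at hc
  have hpos : ∀ x ∈ D, 0 < φ (R (T x)) := fun x hx =>
    hc.trans (hφ _ (Set.mem_image_of_mem _ hx))
  let starL : FreeAlgebra ℝ (Fin g) →ₗ[ℝ] FreeAlgebra ℝ (Fin g) :=
    { toFun := star, map_add' := star_add, map_smul' := star_smul_real }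
  let L : FreeAlgebra ℝ (Fin g) →ₗ[ℝ] ℝ :=
    (φ.toLinearMap ∘ₗ R) + (φ.toLinearMap ∘ₗ R) ∘ₗ starL
  have hL : ∀ f, L f = φ (R f) + φ (R (star f)) := fun f => rfl
  refine ⟨L, fun f => by rw [hL, hL, star_star, add_comm], ?_, ?_⟩
  · have := hpos (0, 1) ⟨PosSemidef.zero, zero_le_one, by simp⟩
    rw [hT, map_zero, zero_add, one_smul] at this
    rw [hL, hsym]
    linarith
  · intro f hf hf0
    obtain ⟨c, rfl⟩ := (Submodule.mem_span_range_iff_exists_fun ℝ).1 hf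
    have hS : 0 < c ⬝ᵥ c := by
      refine lt_of_le_of_ne (by simpa using dotProduct_star_self_nonneg c) fun h => hf0 ?_
      simp [dotProduct_self_eq_zero.1 h.symm]
    have := hpos ((c ⬝ᵥ c)⁻¹ • vecMulVec c c, 0)
      ⟨(by simpa using posSemidef_vecMulVec_self_star c : (vecMulVec c c).PosSemidef).smul
        (inv_nonneg.2 hS.le), le_rfl, by simp [trace_vecMulVec, hS.ne']⟩
    rw [hT, zero_smul, add_zero, map_smul, ← star_mul_sum_mon, map_smul, map_smul, smul_eq_mul]
      at this
    have h2 := pos_of_mul_pos_right this (inv_nonneg.2 hS.le)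
    rw [hL, star_mul, star_star]
    linarith

lemma evalMat_mon {ι' : Type} [Fintype ι'] [DecidableEq ι']
    (X : Fin g → Matrix ι' ι' ℝ) (w : FreeMonoid (Fin g)) :
    evalMat (mon w) X = FreeMonoid.lift X w := by
  rw [mon_eq, evalMat]
  induction w using FreeMonoid.recOn with
  | one => simp
  | of_mul j w ih => simp [ih]

lemma evalMat_eq_sum {ι' : Type} [Fintype ι'] [DecidableEq ι']
    (f : FreeAlgebra ℝ (Fin g)) (X : Fin g → Matrix ι' ι' ℝ) :
    evalMat f X = ∑ w ∈ (coef f).support, coef f w • FreeMonoid.lift X w := by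
  conv_lhs => rw [eq_sum_mon f]
  simp only [← evalMat_mon]
  simp [evalMat]

/-- A finite-dimensional space of polynomials carries an orthonormal basis for a positive
functional, and every element expands in it. -/
lemma exists_orthonormal_expansion (L : FreeAlgebra ℝ (Fin g) →ₗ[ℝ] ℝ)
    (hstar : ∀ f, L (star f) = L f) (V : Submodule ℝ (FreeAlgebra ℝ (Fin g)))
    [FiniteDimensional ℝ V] (hpos : ∀ f ∈ V, f ≠ 0 → 0 < L (star f * f)) :
    ∃ (n : ℕ) (b : Fin n → FreeAlgebra ℝ (Fin g)), (∀ i, b i ∈ V) ∧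
      ∀ f ∈ V, f = ∑ i, L (star (b i) * f) • b i := by
  let B : LinearMap.BilinForm ℝ V := LinearMap.mk₂ ℝ (fun a b : V => L (star a.1 * b.1))
    (fun a a' b => by simp [add_mul]) (fun r a b => by simp [star_smul_real])
    (fun a b b' => by simp [mul_add]) (fun r a b => by simp)
  have hB : ∀ a b : V, B a b = L (star a.1 * b.1) := fun a b => rfl
  have hsymm : LinearMap.IsSymm B := ⟨fun a b => by
    rw [RingHom.id_apply, hB, hB, ← hstar, star_mul, star_star]⟩
  have : Invertible (2 : ℝ) := invertibleOfNonzero two_ne_zero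
  obtain ⟨v, hv⟩ := LinearMap.BilinForm.exists_orthogonal_basis hsymm
  have hvp : ∀ i, 0 < B (v i) (v i) := fun i =>
    hpos _ (v i).2 fun h => v.ne_zero i (Subtype.ext h)
  refine ⟨_, fun i => (Real.sqrt (B (v i) (v i)))⁻¹ • (v i).1, fun i => V.smul_mem _ (v i).2,
    fun f hf => ?_⟩
  have hc : ∀ i, L (star (v i).1 * f) = v.repr ⟨f, hf⟩ i * B (v i) (v i) := fun i => by
    have h1 : L (star (v i).1 * f) = B (v i) ⟨f, hf⟩ := rfl
    rw [h1]
    conv_lhs => rw [← v.sum_repr ⟨f, hf⟩]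
    rw [map_sum, Finset.sum_eq_single i]
    · simp
    · intro j _ hj
      rw [map_smul, hv hj.symm, smul_zero]
    · simp
  have hsum := congrArg Subtype.val (v.sum_repr ⟨f, hf⟩)
  simp only [Submodule.coe_sum, Submodule.coe_smul] at hsum
  rw [← hsum]
  refine Finset.sum_congr rfl fun i _ => ?_
  rw [hsum, star_smul_real, smul_mul_assoc, map_smul, hc, smul_eq_mul, smul_smul]
  congr 1
  have hs := Real.mul_self_sqrt (hvp i).le
  have hs0 := (Real.sqrt_pos.2 (hvp i)).ne'
  generalize Real.sqrt (B (v i) (v i)) = s at *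
  rw [← hs]
  field_simp

/-- A symmetric polynomial `p` for which `-p` is not a sum of squares takes a positive value as a
quadratic form at some tuple of symmetric matrices. -/
lemma exists_quadForm_pos {p : FreeAlgebra ℝ (Fin g)} (hsym : star p = p)
    (hp : ¬ IsHermitianSOS (-p)) :
    ∃ (n : ℕ) (Y : Fin g → Matrix (Fin n) (Fin n) ℝ) (w : Fin n → ℝ), (∀ j, (Y j).IsSymm) ∧
      0 < w ⬝ᵥ evalMat p Y *ᵥ w := by
  classical
  let e := (coef p).support.sup FreeMonoid.length
  have hfin : {w : FreeMonoid (Fin g) | w.length ≤ e}.Finite := List.finite_length_le (Fin g) e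
  have : Fintype {w : FreeMonoid (Fin g) | w.length ≤ e} := hfin.fintype
  obtain ⟨L, hstar, hLp, hpos⟩ := exists_positive_functional
    (w := fun w : {w : FreeMonoid (Fin g) | w.length ≤ e} => w.1) Subtype.val_injective hsym hp
  set V := Submodule.span ℝ (Set.range fun w : {w : FreeMonoid (Fin g) | w.length ≤ e} => mon w.1)
  have hV : ∀ w : FreeMonoid (Fin g), w.length ≤ e → mon w ∈ V := fun w hw =>
    Submodule.subset_span ⟨⟨w, hw⟩, rfl⟩
  have : FiniteDimensional ℝ V := FiniteDimensional.span_of_finite ℝ (Set.finite_range _)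
  obtain ⟨n, b, hb, hexp⟩ := exists_orthonormal_expansion L hstar V hpos
  let Y : Fin g → Matrix (Fin n) (Fin n) ℝ := fun j => of fun i k => L (star (b i) * (ι ℝ j * b k))
  let c : FreeAlgebra ℝ (Fin g) → Fin n → ℝ := fun f i => L (star (b i) * f)
  have hY : ∀ j, ∀ f ∈ V, Y j *ᵥ c f = c (ι ℝ j * f) := by
    intro j f hf
    ext i
    conv_rhs => rw [hexp f hf]
    simp [c, Y, mulVec, dotProduct, Finset.mul_sum, mul_comm]
  have hword : ∀ w : FreeMonoid (Fin g), w.length ≤ e →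
      FreeMonoid.lift Y w *ᵥ c 1 = c (mon w) := by
    intro w
    induction w using FreeMonoid.recOn with
    | one => intro _; simp [mon_one]
    | of_mul j w ih =>
      intro hw
      rw [FreeMonoid.length_mul, FreeMonoid.length_of] at hw
      rw [map_mul, ← mulVec_mulVec, ih (by omega), FreeMonoid.lift_eval_of, hY j _ (hV w (by omega)),
        mon_mul, mon_of]
  refine ⟨n, Y, c 1, fun j => ?_, ?_⟩
  · ext i k
    simp only [Y, transpose_apply, of_apply]
    rw [← hstar, star_mul, star_mul, star_ι, star_star, mul_assoc]
  · have h1 : evalMat p Y *ᵥ c 1 = c p := by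
      rw [evalMat_eq_sum, sum_mulVec]
      have : ∀ w ∈ (coef p).support, (coef p w • FreeMonoid.lift Y w) *ᵥ c 1
          = coef p w • c (mon w) := fun w hw => by
        rw [smul_mulVec, hword w (Finset.le_sup hw)]
      rw [Finset.sum_congr rfl this]
      ext i
      conv_rhs => rw [eq_sum_mon p]
      simp [c, Finset.mul_sum]
    have h2 : c 1 ⬝ᵥ c p = L p := by
      have h3 : L p = L (star 1 * p) := by simp
      rw [h3]
      conv_rhs => rw [hexp 1 (by simpa [mon_one] using hV 1 (by simp))]
      simp [c, dotProduct, star_sum, star_smul_real, Finset.sum_mul]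
    rw [h1, h2]
    exact hLp

/-- The base-`(g + 1)` number whose digits are the letters of `l`, shifted by `b` places. -/
def wordExponent (b : ℕ) : List (Fin g) → ℕ
  | [] => 0
  | j :: l => j * (g + 1) ^ (b + l.length) + wordExponent b l

lemma wordExponent_lt (b : ℕ) (l : List (Fin g)) :
    wordExponent b l < (g + 1) ^ (b + l.length) := by
  induction l with
  | nil => simp [wordExponent]
  | cons j l ih =>
    have h1 : (j : ℕ) * (g + 1) ^ (b + l.length) ≤ g * (g + 1) ^ (b + l.length) :=
      Nat.mul_le_mul_right _ j.2.le
    have h2 : (g + 1) ^ (b + (j :: l).length)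
        = g * (g + 1) ^ (b + l.length) + (g + 1) ^ (b + l.length) := by
      rw [List.length_cons, ← add_assoc, pow_succ]; ring
    rw [wordExponent, h2]
    omega

lemma wordExponent_injective (b : ℕ) {l l' : List (Fin g)} (hl : l.length = l'.length)
    (h : wordExponent b l = wordExponent b l') : l = l' := by
  induction l generalizing l' with
  | nil => exact (List.length_eq_zero_iff.1 hl.symm).symm
  | cons j l ih =>
    obtain _ | ⟨j', l'⟩ := l'
    · simp at hl
    · simp only [List.length_cons, add_left_inj] at hl
      have h1 := wordExponent_lt b l
      have h2 := wordExponent_lt b l'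
      simp only [wordExponent, hl] at h h1
      have hdiv := congrArg (· / (g + 1) ^ (b + l'.length)) h
      have hmod := congrArg (· % (g + 1) ^ (b + l'.length)) h
      simp only [Nat.mul_add_mod_of_lt h1, Nat.mul_add_mod_of_lt h2] at hmod
      rw [Nat.mul_comm, Nat.mul_comm (j' : ℕ)] at hdiv
      have hpos : 0 < (g + 1) ^ (b + l'.length) := Nat.pow_pos (Nat.succ_pos g)
      simp only [Nat.mul_add_div hpos, Nat.div_eq_of_lt h1,
        Nat.div_eq_of_lt h2, add_zero] at hdiv
      rw [Fin.ext hdiv, ih hl hmod]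

/-- Symmetric tridiagonal matrices with zero diagonal, whose off-diagonal entries are powers
of `t` separating words. -/
def bandMatrix (N : ℕ) (t : ℝ) (j : Fin g) : Matrix (Fin N) (Fin N) ℝ :=
  of fun a b => if (a : ℕ) = b + 1 then t ^ (j * (g + 1) ^ (b : ℕ)) else
    if (b : ℕ) = a + 1 then t ^ (j * (g + 1) ^ (a : ℕ)) else 0

lemma bandMatrix_isSymm (N : ℕ) (t : ℝ) (j : Fin g) : (bandMatrix N t j).IsSymm := by
  ext a b
  simp only [bandMatrix, transpose_apply, of_apply]
  split_ifs <;> first | rfl | omega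

lemma bandMatrix_word_apply {g N : ℕ} (t : ℝ) (l : List (Fin g)) (a b : Fin N) :
    ((b : ℕ) + l.length < a → (l.map (bandMatrix N t)).prod a b = 0) ∧
    ((a : ℕ) = b + l.length → (l.map (bandMatrix N t)).prod a b = t ^ wordExponent b l) := by
  induction l generalizing a with
  | nil =>
    constructor
    · intro h
      have : a ≠ b := fun hab => by simp [hab] at h
      simp [one_apply_ne this]
    · intro h
      have : a = b := Fin.ext (by simpa using h)
      simp [this, wordExponent]
  | cons j l ih =>
    simp only [List.map_cons, List.prod_cons, List.length_cons, mul_apply]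
    constructor
    · intro h
      refine Finset.sum_eq_zero fun c _ => ?_
      by_cases hc : (b : ℕ) + l.length < c
      · rw [(ih c).1 hc, mul_zero]
      · rw [bandMatrix, of_apply, if_neg (by omega), if_neg (by omega), zero_mul]
    · intro h
      let c₀ : Fin N := ⟨b + l.length, by omega⟩
      rw [Finset.sum_eq_single c₀]
      · rw [(ih c₀).2 rfl, bandMatrix, of_apply, if_pos (by simp [c₀]; omega), wordExponent, pow_add t]
      · intro c _ hc
        have hc' : (c : ℕ) ≠ b + l.length := fun h' => hc (Fin.ext h')
        by_cases hlt : (b : ℕ) + l.length < c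
        · rw [(ih c).1 hlt, mul_zero]
        · rw [bandMatrix, of_apply, if_neg (by omega), if_neg (by omega), zero_mul]
      · simp

/-- A nonzero polynomial of degree `d` attains rank at least `k` on symmetric matrices of
size `k + d`. -/
lemma exists_minor_ne_zero {q : FreeAlgebra ℝ (Fin g)} (hq : q ≠ 0) :
    ∃ d : ℕ, ∀ k : ℕ, ∃ Z : Fin g → Matrix (Fin (k + d)) (Fin (k + d)) ℝ, (∀ j, (Z j).IsSymm) ∧
      ((evalMat q Z).submatrix (fun i : Fin k => i.addNat d) (Fin.castAdd d)).det ≠ 0 := by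
  classical
  have hne : (coef q).support.Nonempty := by
    rw [Finsupp.support_nonempty_iff]
    exact fun h => hq ((basisFreeMonoid ℝ (Fin g)).repr.map_eq_zero_iff.1 h)
  obtain ⟨w₀, hw₀, hmax⟩ := (coef q).support.exists_max_image FreeMonoid.length hne
  refine ⟨w₀.length, fun k => ?_⟩
  let P : ℕ → Polynomial ℝ := fun m => ∑ w ∈ (coef q).support with w.length = w₀.length,
    Polynomial.monomial (wordExponent m w.toList) (coef q w)
  have hP : ∀ m, P m ≠ 0 := fun m h => by
    have h1 := congrArg (fun f => f.coeff (wordExponent m w₀.toList)) h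
    simp only [P, Polynomial.finsetSum_coeff, Polynomial.coeff_monomial, Polynomial.coeff_zero]
      at h1
    rw [Finset.sum_eq_single_of_mem w₀ (by simpa using hw₀), if_pos rfl] at h1
    · simp at hw₀; exact hw₀ h1
    · intro w hw hww
      simp only [Finset.mem_filter] at hw
      exact if_neg fun h => hww (wordExponent_injective m hw.2 h)
  have hprod : ∏ m ∈ Finset.range k, P m ≠ 0 := Finset.prod_ne_zero_iff.2 fun m _ => hP m
  obtain ⟨t, ht⟩ : ∃ t, Polynomial.eval t (∏ m ∈ Finset.range k, P m) ≠ 0 := by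
    by_contra! hc
    exact hprod (Polynomial.funext fun t => by simp [hc t])
  rw [Polynomial.eval_prod, Finset.prod_ne_zero_iff] at ht
  refine ⟨bandMatrix _ t, bandMatrix_isSymm _ t, ?_⟩
  have hentry : ∀ a b : Fin (k + w₀.length), evalMat q (bandMatrix _ t) a b =
      ∑ w ∈ (coef q).support, coef q w * (w.toList.map (bandMatrix _ t)).prod a b := fun a b => by
    simp [evalMat_eq_sum, Matrix.sum_apply, FreeMonoid.lift_apply]
  rw [det_of_isUpperTriangular, Finset.prod_ne_zero_iff]
  · intro i _
    have hi := ht i (by simp)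
    rw [submatrix_apply, hentry]
    convert hi using 1
    rw [Polynomial.eval_finsetSum, Finset.sum_filter]
    refine Finset.sum_congr rfl fun w hw => ?_
    split_ifs with hlen
    · rw [Polynomial.eval_monomial, (bandMatrix_word_apply t w.toList _ _).2]
      · rfl
      · exact (congrArg ((i : ℕ) + ·) hlen).symm
    · have := lt_of_le_of_ne (hmax w hw) hlen
      rw [(bandMatrix_word_apply t w.toList _ _).1, mul_zero]
      exact Nat.add_lt_add_left this i
  · intro i j hij
    rw [submatrix_apply, hentry]
    refine Finset.sum_eq_zero fun w hw => ?_
    rw [(bandMatrix_word_apply t w.toList _ _).1, mul_zero]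
    have h1 : (w.toList.length : ℕ) ≤ w₀.length := hmax w hw
    have h2 : (j : ℕ) < i := hij
    simp only [Fin.val_castAdd, Fin.val_addNat]
    omega

lemma map_lift_eq_evalMat {A : Type*} [Ring A] [Algebra ℝ A] {κ : Type} [Fintype κ]
    [DecidableEq κ] (φ : A →ₐ[ℝ] Matrix κ κ ℝ) (Y : Fin g → A) (f : FreeAlgebra ℝ (Fin g)) :
    evalMat f (fun j => φ (Y j)) = φ (FreeAlgebra.lift ℝ Y f) := by
  have : FreeAlgebra.lift ℝ (fun j => φ (Y j)) = φ.comp (FreeAlgebra.lift ℝ Y) := by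
    ext; simp
  rw [evalMat, this]; rfl

lemma evalMat_star {κ : Type} [Fintype κ] [DecidableEq κ] {X : Fin g → Matrix κ κ ℝ}
    (hX : ∀ j, (X j).IsSymm) (f : FreeAlgebra ℝ (Fin g)) :
    evalMat (star f) X = (evalMat f X)ᵀ := by
  simp only [evalMat]
  induction f with
  | grade0 r => rw [star_algebraMap, AlgHom.commutes]; simp [Algebra.algebraMap_eq_smul_one]
  | grade1 j => simpa using (hX j).symm
  | mul a b ha hb => simp [ha, hb]
  | add a b ha hb => simp [ha, hb]

/-- A quadratic form is nonpositive off the span of its positive eigenvectors. -/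
lemma quadForm_nonpos_of_orthogonal {κ : Type*} [Fintype κ] {P : Matrix κ κ ℝ}
    (hP : P.IsHermitian) {y : κ → ℝ}
    (hy : ∀ (v : κ → ℝ) (r : ℝ), v ≠ 0 → 0 < r → P *ᵥ v = r • v → v ⬝ᵥ y = 0) :
    y ⬝ᵥ P *ᵥ y ≤ 0 := by
  classical
  have h1 := hP.eigenvectorBasis.sum_inner_mul_inner (WithLp.toLp 2 (P *ᵥ y)) (WithLp.toLp 2 y)
  simp only [EuclideanSpace.inner_eq_star_dotProduct, star_trivial] at h1
  rw [← h1]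
  refine Finset.sum_nonpos fun i _ => ?_
  set v : κ → ℝ := (hP.eigenvectorBasis i).ofLp with hv
  have hv0 : v ≠ 0 := fun h => hP.eigenvectorBasis.orthonormal.ne_zero i (by
    ext k; exact congrFun h k)
  have hev : P *ᵥ v = hP.eigenvalues i • v := hP.mulVec_eigenvectorBasis i
  have h2 : v ⬝ᵥ P *ᵥ y = hP.eigenvalues i * (v ⬝ᵥ y) := by
    have hPt : Pᵀ = P := by simpa [IsHermitian, conjTranspose_eq_transpose_of_trivial] using hP
    rw [dotProduct_mulVec, ← mulVec_transpose, hPt, hev, smul_dotProduct, smul_eq_mul]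
  rw [dotProduct_comm y v, h2, mul_assoc]
  by_cases hl : 0 < hP.eigenvalues i
  · rw [hy v _ hv0 hl hev]; simp
  · exact mul_nonpos_of_nonpos_of_nonneg (not_lt.1 hl) (mul_self_nonneg _)

/-- Evaluation along an affine line of tuples is polynomial in the parameter. -/
lemma exists_polynomial_evalMat_line {κ : Type} [Fintype κ] [DecidableEq κ]
    (A B : Fin g → Matrix κ κ ℝ) (f : FreeAlgebra ℝ (Fin g)) :
    ∃ Q : Matrix κ κ (Polynomial ℝ), ∀ t : ℝ,
      evalMat f (fun j => A j + t • B j) = Q.map (Polynomial.eval t) := by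
  refine ⟨FreeAlgebra.lift ℝ (fun j => (A j).map Polynomial.C +
    (Polynomial.X : Polynomial ℝ) • (B j).map Polynomial.C) f, fun t => ?_⟩
  have h := map_lift_eq_evalMat (Polynomial.aeval t : Polynomial ℝ →ₐ[ℝ] ℝ).mapMatrix
    (fun j => (A j).map Polynomial.C + (Polynomial.X : Polynomial ℝ) • (B j).map Polynomial.C) f
  simp only [AlgHom.mapMatrix_apply, Polynomial.coe_aeval_eq_eval] at h
  rw [← h]
  congr 1
  ext j a b
  simp [mul_comm t]

/-- `m` diagonal copies of a matrix, as an algebra homomorphism. -/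
def diagonalCopies (κ μ : Type*) [Fintype κ] [DecidableEq κ] [Fintype μ] [DecidableEq μ] :
    Matrix κ κ ℝ →ₐ[ℝ] Matrix (κ × μ) (κ × μ) ℝ :=
  AlgHom.ofLinearMap
    { toFun := fun M => blockDiagonal fun _ => M
      map_add' := fun M M' => blockDiagonal_add (fun _ => M) fun _ => M'
      map_smul' := fun r M => blockDiagonal_smul r fun _ => M }
    blockDiagonal_one (fun M M' => blockDiagonal_mul (fun _ => M) fun _ => M')

lemma diagonalCopies_apply {κ μ : Type*} [Fintype κ] [DecidableEq κ] [Fintype μ] [DecidableEq μ]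
    (M : Matrix κ κ ℝ) : diagonalCopies κ μ M = blockDiagonal fun _ => M := rfl

lemma quadForm_diagonalCopies {κ μ : Type*} [Fintype κ] [DecidableEq κ] [Fintype μ]
    [DecidableEq μ] (M : Matrix κ κ ℝ) (w : κ → ℝ) (a : μ → ℝ) :
    (fun x : κ × μ => w x.1 * a x.2) ⬝ᵥ
      (diagonalCopies κ μ M *ᵥ fun x : κ × μ => w x.1 * a x.2) =
      (a ⬝ᵥ a) * (w ⬝ᵥ M *ᵥ w) := by
  have h : (diagonalCopies κ μ M *ᵥ fun x : κ × μ => w x.1 * a x.2) =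
      fun x => (M *ᵥ w) x.1 * a x.2 := by
    ext ⟨i, u⟩
    simp only [diagonalCopies_apply, mulVec, dotProduct, blockDiagonal_apply,
      Fintype.sum_prod_type, ite_mul, zero_mul, Finset.sum_ite_eq, Finset.mem_univ, if_true,
      Finset.sum_mul, mul_assoc]
  rw [h, mul_comm]
  simp only [dotProduct, Fintype.sum_prod_type, Finset.sum_mul_sum]
  refine Finset.sum_congr rfl fun i _ => Finset.sum_congr rfl fun u _ => ?_
  ring

/-- A tuple of matrices with a quadratic form positive on a subspace of prescribed dimension. -/
lemma exists_quadForm_pos_on {p : FreeAlgebra ℝ (Fin g)} (hsym : star p = p)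
    (hp : ¬ IsHermitianSOS (-p)) (d : ℕ) :
    ∃ (k : ℕ) (Y : Fin g → Matrix (Fin (k + d)) (Fin (k + d)) ℝ)
      (J : (Fin (d + 1) → ℝ) →ₗ[ℝ] (Fin (k + d) → ℝ)), (∀ j, (Y j).IsSymm) ∧
      ∀ a, a ≠ 0 → 0 < J a ⬝ᵥ evalMat p Y *ᵥ J a := by
  obtain ⟨n, Y, w, hY, hw⟩ := exists_quadForm_pos hsym hp
  have hn : 0 < n := by
    rcases Nat.eq_zero_or_pos n with rfl | h
    · simp [dotProduct] at hw
    · exact h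
  obtain ⟨k, hk⟩ : ∃ k, n * (d + 1) = k + d :=
    ⟨n * (d + 1) - d, by have := Nat.mul_le_mul_right (d + 1) hn; omega⟩
  let e : Fin n × Fin (d + 1) ≃ Fin (k + d) := finProdFinEquiv.trans (finCongr hk)
  let φ : Matrix (Fin n) (Fin n) ℝ →ₐ[ℝ] Matrix (Fin (k + d)) (Fin (k + d)) ℝ :=
    (reindexAlgEquiv ℝ ℝ e).toAlgHom.comp (diagonalCopies (Fin n) (Fin (d + 1)))
  have hφ : ∀ M, φ M = (diagonalCopies (Fin n) (Fin (d + 1)) M).submatrix e.symm e.symm :=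
    fun M => rfl
  let J : (Fin (d + 1) → ℝ) →ₗ[ℝ] (Fin (k + d) → ℝ) :=
    { toFun := fun a => (fun x : Fin n × Fin (d + 1) => w x.1 * a x.2) ∘ e.symm
      map_add' := fun a b => by ext; simp [mul_add]
      map_smul' := fun r a => by ext; simp; ring }
  have hJ : ∀ a, J a = (fun x : Fin n × Fin (d + 1) => w x.1 * a x.2) ∘ e.symm := fun a => rfl
  refine ⟨k, fun j => φ (Y j), J, fun j => ?_, fun a ha => ?_⟩
  · show (φ (Y j)).IsSymm
    rw [hφ, IsSymm, transpose_submatrix, diagonalCopies_apply, blockDiagonal_transpose]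
    simp only [(hY j).eq]
  · rw [map_lift_eq_evalMat, hφ, hJ, submatrix_mulVec_equiv, Equiv.symm_symm, Function.comp_assoc,
      Equiv.symm_comp_self, Function.comp_id, comp_equiv_dotProduct_comp_equiv,
      quadForm_diagonalCopies]
    refine mul_pos ?_ hw
    exact lt_of_le_of_ne (by simpa using dotProduct_star_self_nonneg a)
      fun h => ha (dotProduct_self_eq_zero.1 h.symm)

/-- If `F` vanishes on the positive eigenvectors of `P`, then `P` is nonpositive on the range
of `Fᵀ`. -/
lemma quadForm_transpose_mulVec_nonpos {κ : Type*} [Fintype κ] {P F : Matrix κ κ ℝ}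
    (hP : P.IsSymm)
    (hF : ∀ v : κ → ℝ, v ≠ 0 → ∀ r : ℝ, 0 < r → P *ᵥ v = r • v → F *ᵥ v = 0) (u : κ → ℝ) :
    (Fᵀ *ᵥ u) ⬝ᵥ P *ᵥ (Fᵀ *ᵥ u) ≤ 0 := by
  refine quadForm_nonpos_of_orthogonal (by
    rwa [IsHermitian, conjTranspose_eq_transpose_of_trivial]) fun v r hv hr h => ?_
  rw [dotProduct_mulVec, vecMul_transpose, hF v hv r hr h, zero_dotProduct]

/-- A matrix with an invertible `k × k` block cannot have its range miss the image of an
injective map from dimension `d + 1` into dimension `k + d`. -/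
lemma exists_mulVec_eq_of_minor_ne_zero {k d : ℕ} {F : Matrix (Fin (k + d)) (Fin (k + d)) ℝ}
    (r c : Fin k → Fin (k + d)) (hF : (F.submatrix r c).det ≠ 0)
    {J : (Fin (d + 1) → ℝ) →ₗ[ℝ] (Fin (k + d) → ℝ)} (hJ : Function.Injective J) :
    ∃ a u, a ≠ 0 ∧ Fᵀ *ᵥ u = J a := by
  have h1 : k ≤ Module.finrank ℝ (LinearMap.range Fᵀ.mulVecLin) := by
    have : k = (F.submatrix r c).rank := by
      rw [rank_of_isUnit _ ((isUnit_iff_isUnit_det _).2 hF.isUnit), Fintype.card_fin]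
    refine this.le.trans (le_trans (rank_submatrix_le F r c) ?_)
    rw [← rank_transpose F]; rfl
  have h2 : Module.finrank ℝ (LinearMap.range J) = d + 1 := by
    rw [LinearMap.finrank_range_of_inj hJ]; simp
  by_contra! hne
  have hd : Disjoint (LinearMap.range Fᵀ.mulVecLin) (LinearMap.range J) := by
    rw [Submodule.disjoint_def]
    rintro _ ⟨u, rfl⟩ ⟨a, ha⟩
    by_cases h0 : a = 0
    · rw [← ha, h0, map_zero]
    · exact absurd ha.symm (hne a u h0)
  have h3 := Submodule.finrank_add_finrank_le_of_disjoint hd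
  rw [Module.finrank_fin_fun] at h3
  omega

/-- Nonvanishing of a minor of an evaluation at one point of a line forces it near any other. -/
lemma eventually_minor_ne_zero {κ μ : Type} [Fintype κ] [DecidableEq κ] [Fintype μ]
    [DecidableEq μ] (A B : Fin g → Matrix κ κ ℝ) (f : FreeAlgebra ℝ (Fin g)) (r c : μ → κ)
    {s : ℝ} (hs : ((evalMat f fun j => A j + s • B j).submatrix r c).det ≠ 0) (t₀ : ℝ) :
    ∀ᶠ t in 𝓝[≠] t₀, ((evalMat f fun j => A j + t • B j).submatrix r c).det ≠ 0 := by
  obtain ⟨Q, hQ⟩ := exists_polynomial_evalMat_line A B f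
  have h : ∀ t, ((evalMat f fun j => A j + t • B j).submatrix r c).det =
      (Q.submatrix r c).det.eval t := fun t => by
    rw [hQ, ← Polynomial.coe_evalRingHom, RingHom.map_det]; rfl
  simp only [h] at hs ⊢
  have h0 : (Q.submatrix r c).det ≠ 0 := by
    intro h0; simp [h0] at hs
  have hfin := Polynomial.finite_setOfPred_isRoot h0
  have := (hfin.subset (Set.sdiff_subset (t := {t₀}))).isClosed.isOpen_compl.mem_nhds
    (show t₀ ∈ _ by simp)
  filter_upwards [nhdsWithin_le_nhds this, self_mem_nhdsWithin] with t ht ht' h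
  exact ht ⟨h, ht'⟩

/-- Positivity of a quadratic form on a subspace is stable under moving the tuple on a line. -/
lemma eventually_quadForm_pos {g m : ℕ} {κ : Type} [Fintype κ] [DecidableEq κ]
    (A B : Fin g → Matrix κ κ ℝ) (f : FreeAlgebra ℝ (Fin g))
    (J : (Fin m → ℝ) →ₗ[ℝ] (κ → ℝ))
    (hJ : ∀ a, a ≠ 0 → 0 < J a ⬝ᵥ evalMat f A *ᵥ J a) :
    ∀ᶠ t in 𝓝 (0 : ℝ), ∀ a, a ≠ 0 →
      0 < J a ⬝ᵥ (evalMat f fun j => A j + t • B j) *ᵥ J a := by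
  obtain ⟨Q, hQ⟩ := exists_polynomial_evalMat_line A B f
  have hJc : Continuous J := LinearMap.continuous_of_finiteDimensional J
  have hcont : Continuous fun x : ℝ × (Fin m → ℝ) =>
      J x.2 ⬝ᵥ (evalMat f fun j => A j + x.1 • B j) *ᵥ J x.2 := by
    simp only [hQ]
    have h1 : Continuous fun x : ℝ × (Fin m → ℝ) => Q.map (Polynomial.eval x.1) :=
      continuous_matrix fun i j => (Q i j).continuous.comp continuous_fst
    exact (hJc.comp continuous_snd).dotProduct (h1.matrix_mulVec (hJc.comp continuous_snd))
  have hev : ∀ᶠ t in 𝓝 (0 : ℝ), ∀ a ∈ Metric.sphere (0 : Fin m → ℝ) 1,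
      0 < J a ⬝ᵥ (evalMat f fun j => A j + t • B j) *ᵥ J a := by
    refine (isCompact_sphere _ _).eventually_forall_of_forall_eventually fun a ha => ?_
    refine (hcont.tendsto (0, a)).eventually_const_lt ?_
    simpa using hJ a (ne_zero_of_mem_unit_sphere ⟨a, ha⟩)
  filter_upwards [hev] with t ht a ha
  have hn : 0 < ‖a‖ := norm_pos_iff.2 ha
  have h := ht (‖a‖⁻¹ • a) (by simp [norm_smul, hn.ne'])
  simp only [map_smul, mulVec_smul, dotProduct_smul, smul_dotProduct, smul_eq_mul] at h
  exact pos_of_mul_pos_right (pos_of_mul_pos_right h (by positivity)) (by positivity)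

end FreePoly

/-- if `-p` is not a hermitian sum of squares and `q(X)v = 0` whenever `v` is an
eigenvector of `p(X)` with positive eigenvalue (for a symmetric tuple `X` of any size), then
`q = 0`. -/
theorem stmt_15 (g : ℕ) (p : FreeAlgebra ℝ (Fin g)) (hsym : star p = p)
    (hnsos : ¬ IsHermitianSOS (-p)) (q : FreeAlgebra ℝ (Fin g))
    (hq : ∀ n : ℕ, 0 < n → ∀ X : Fin g → Matrix (Fin n) (Fin n) ℝ,
      (∀ j, (X j).IsSymm) → ∀ v : Fin n → ℝ, v ≠ 0 → ∀ lam : ℝ, 0 < lam →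
        (evalMat p X).mulVec v = lam • v → (evalMat q X).mulVec v = 0) :
    q = 0 := by
  by_contra hq0
  obtain ⟨d, hd⟩ := FreePoly.exists_minor_ne_zero hq0
  obtain ⟨k, Y, J, hY, hJ⟩ := FreePoly.exists_quadForm_pos_on hsym hnsos d
  obtain ⟨Z, hZ, hdet⟩ := hd k
  obtain ⟨t, hpos, ht⟩ := ((FreePoly.eventually_quadForm_pos Y (fun j => Z j - Y j) p J
    hJ).filter_mono nhdsWithin_le_nhds |>.and (FreePoly.eventually_minor_ne_zero Y
    (fun j => Z j - Y j) q _ _ (s := 1) (by simpa using hdet) 0)).exists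
  have hX : ∀ j, (Y j + t • (Z j - Y j)).IsSymm := fun j =>
    (hY j).add (((hZ j).sub (hY j)).smul t)
  have hJinj : Function.Injective J := by
    rw [injective_iff_map_eq_zero]
    intro a ha
    by_contra h0
    simpa [ha] using hJ a h0
  obtain ⟨a, u, ha, hu⟩ := FreePoly.exists_mulVec_eq_of_minor_ne_zero _ _ ht hJinj
  have hN : 0 < k + d := by
    rcases Nat.eq_zero_or_pos (k + d) with h | h
    · have : IsEmpty (Fin (k + d)) := h ▸ Fin.isEmpty'
      simpa [dotProduct] using hJ a ha
    · exact h
  have hsymX : (evalMat p fun j => Y j + t • (Z j - Y j)).IsSymm := by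
    rw [Matrix.IsSymm, ← FreePoly.evalMat_star hX, hsym]
  have h := FreePoly.quadForm_transpose_mulVec_nonpos hsymX (hq (k + d) hN _ hX) u
  rw [hu] at h
  exact (hpos a ha).not_ge h
end
end
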